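/- arXiv:math/0004047 — 3 statements merged into one kernel-verified Lean document; each statement's English description precedes it below -/
import Mathlib

section
/- There is no infinite order-polynomially complete bounded lattice: if L is a bounded lattice such that for every n ∈ ℕ every monotone function f : L^n → L is an n-ary polynomial function on L, then L is finite. -/
universe u

/-- `IsPolyFn L n p` says that `p : (Fin n → L) → L` is an `n`-ary lattice polynomial
function on `L`: it lies in the smallest set of functions containing the coordinate
projections and all constant functions and closed under pointwise join and meet. -/
inductive IsPolyFn (L : Type u) [Lattice L] (n : ℕ) : ((Fin n → L) → L) → Prop
  | proj (i : Fin n) : IsPolyFn L n fun x => x i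
  | const (c : L) : IsPolyFn L n fun _ => c
  | sup {p q : (Fin n → L) → L} : IsPolyFn L n p → IsPolyFn L n q →
      IsPolyFn L n fun x => p x ⊔ q x
  | inf {p q : (Fin n → L) → L} : IsPolyFn L n p → IsPolyFn L n q →
      IsPolyFn L n fun x => p x ⊓ q x

/-- Lattice terms with variables from `α`. -/
inductive LatticeTerm (α : Type*)
  | var (i : α) : LatticeTerm α
  | sup (s t : LatticeTerm α) : LatticeTerm α
  | inf (s t : LatticeTerm α) : LatticeTerm α

namespace LatticeTerm

/-- The value of a lattice term under an assignment of its variables. -/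
def eval {α : Type*} {L : Type*} [Lattice L] (v : α → L) : LatticeTerm α → L
  | var i => v i
  | sup s t => s.eval v ⊔ t.eval v
  | inf s t => s.eval v ⊓ t.eval v

/-- Renaming of variables. -/
def map {α β : Type*} (ρ : α → β) : LatticeTerm α → LatticeTerm β
  | var i => var (ρ i)
  | sup s t => sup (s.map ρ) (t.map ρ)
  | inf s t => inf (s.map ρ) (t.map ρ)

theorem eval_map {α β L : Type*} [Lattice L] (ρ : α → β) (v : β → L) (t : LatticeTerm α) :
    (t.map ρ).eval v = t.eval (v ∘ ρ) := by
  induction t with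
  | var i => rfl
  | sup s t hs ht => simp only [map, eval, hs, ht]
  | inf s t hs ht => simp only [map, eval, hs, ht]

theorem eval_mono {α L : Type*} [Lattice L] (t : LatticeTerm α) :
    Monotone fun v : α → L => t.eval v := by
  intro v w h
  induction t with
  | var i => exact h i
  | sup s t hs ht => exact sup_le_sup hs ht
  | inf s t hs ht => exact inf_le_inf hs ht

/-- A numbering of the terms over an encodable set of variables. -/
def toNat {α : Type*} [Encodable α] : LatticeTerm α → ℕ
  | var i => Nat.pair 0 (Encodable.encode i)
  | sup s t => Nat.pair 1 (Nat.pair s.toNat t.toNat)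
  | inf s t => Nat.pair 2 (Nat.pair s.toNat t.toNat)

theorem toNat_injective {α : Type*} [Encodable α] :
    Function.Injective (toNat : LatticeTerm α → ℕ) := by
  intro s
  induction s with
  | var i => intro t h; cases t <;> simp_all [toNat]
  | sup s₁ s₂ h₁ h₂ =>
    intro t h
    cases t <;> simp only [toNat, Nat.pair_eq_pair] at h
    · omega
    · rw [h₁ h.2.1, h₂ h.2.2]
    · omega
  | inf s₁ s₂ h₁ h₂ =>
    intro t h
    cases t <;> simp only [toNat, Nat.pair_eq_pair] at h
    · omega
    · omega
    · rw [h₁ h.2.1, h₂ h.2.2]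

instance {α : Type*} [Encodable α] : Countable (LatticeTerm α) :=
  toNat_injective.countable

end LatticeTerm

/-- Every polynomial function is obtained from a lattice term by substituting constants. -/
theorem IsPolyFn.exists_term {L : Type*} [Lattice L] {n : ℕ} {p : (Fin n → L) → L}
    (hp : IsPolyFn L n p) :
    ∃ (k : ℕ) (t : LatticeTerm (Fin n ⊕ Fin k)) (c : Fin k → L),
      ∀ x, p x = t.eval (Sum.elim x c) := by
  have join : ∀ {k l : ℕ} (s : LatticeTerm (Fin n ⊕ Fin k)) (t : LatticeTerm (Fin n ⊕ Fin l))
      (c : Fin k → L) (d : Fin l → L), ∃ s' t' : LatticeTerm (Fin n ⊕ Fin (k + l)), ∀ x,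
        s'.eval (Sum.elim x (Fin.append c d)) = s.eval (Sum.elim x c) ∧
        t'.eval (Sum.elim x (Fin.append c d)) = t.eval (Sum.elim x d) := by
    intro k l s t c d
    refine ⟨s.map (Sum.map id (Fin.castAdd l)), t.map (Sum.map id (Fin.natAdd k)), fun x => ?_⟩
    rw [LatticeTerm.eval_map, LatticeTerm.eval_map]
    constructor <;> congr 1 <;> ext (i | i) <;> simp
  induction hp with
  | proj i => exact ⟨0, .var (.inl i), Fin.elim0, fun x => rfl⟩
  | const c => exact ⟨1, .var (.inr 0), fun _ => c, fun x => rfl⟩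
  | sup _ _ ihp ihq =>
    obtain ⟨k, s, c, hs⟩ := ihp
    obtain ⟨l, t, d, ht⟩ := ihq
    obtain ⟨s', t', h⟩ := join s t c d
    refine ⟨k + l, .sup s' t', Fin.append c d, fun x => ?_⟩
    simp only [LatticeTerm.eval, h, hs, ht]
  | inf _ _ ihp ihq =>
    obtain ⟨k, s, c, hs⟩ := ihp
    obtain ⟨l, t, d, ht⟩ := ihq
    obtain ⟨s', t', h⟩ := join s t c d
    refine ⟨k + l, .inf s' t', Fin.append c d, fun x => ?_⟩
    simp only [LatticeTerm.eval, h, hs, ht]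

theorem IsPolyFn.dual {L : Type*} [Lattice L] {n : ℕ} {p : (Fin n → L) → L}
    (hp : IsPolyFn L n p) : IsPolyFn Lᵒᵈ n p := by
  induction hp with
  | proj i => exact IsPolyFn.proj (L := Lᵒᵈ) i
  | const c => exact IsPolyFn.const (L := Lᵒᵈ) c
  | sup _ _ ihp ihq => exact IsPolyFn.inf (L := Lᵒᵈ) ihp ihq
  | inf _ _ ihp ihq => exact IsPolyFn.sup (L := Lᵒᵈ) ihp ihq

/-- A family of monotone functions indexed by an antichain glues to one monotone function. -/
theorem exists_monotone_glue {P Q L ι : Type*} [Preorder P] [PartialOrder Q] [PartialOrder L]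
    [BoundedOrder L] {a : ι → Q} (ha : ∀ i j, a i ≤ a j → i = j) {f : ι → P → L}
    (hf : ∀ i, Monotone (f i)) :
    ∃ g : P × Q → L, Monotone g ∧ ∀ i x, g (x, a i) = f i x := by
  classical
  let g : P × Q → L := fun z =>
    if h : ∃ i, a i = z.2 then f h.choose z.1 else if ∃ i, a i ≤ z.2 then ⊤ else ⊥
  have hg : ∀ i x, g (x, a i) = f i x := by
    intro i x
    have h : ∃ j, a j = a i := ⟨i, rfl⟩
    have hj : h.choose = i := ha _ _ h.choose_spec.le
    simp only [g, dif_pos h, hj]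
  refine ⟨g, ?_, hg⟩
  rintro ⟨x, y⟩ ⟨x', y'⟩ ⟨hx, hy⟩
  simp only at hx hy
  by_cases h' : ∃ i, a i = y'
  · obtain ⟨i, rfl⟩ := h'
    by_cases h : ∃ j, a j = y
    · obtain ⟨j, rfl⟩ := h
      obtain rfl := ha _ _ hy
      rw [hg, hg]
      exact hf _ hx
    · have hn : ¬ ∃ j, a j ≤ y := by
        rintro ⟨j, hj⟩
        obtain rfl := ha _ _ (hj.trans hy)
        exact h ⟨j, le_antisymm hj hy⟩
      simp only [g, dif_neg h, if_neg hn, bot_le]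
  · by_cases hn : ∃ j, a j ≤ y'
    · have : g (x', y') = ⊤ := by simp only [g, dif_neg h', if_pos hn]
      rw [this]
      exact le_top
    · have h₁ : ¬ ∃ j, a j ≤ y := fun ⟨j, hj⟩ => hn ⟨j, hj.trans hy⟩
      have h₂ : ¬ ∃ j, a j = y := fun ⟨j, hj⟩ => h₁ ⟨j, hj.le⟩
      simp only [g, dif_neg h₂, if_neg h₁, bot_le]

/-- If some power of an order-polynomially complete lattice has an infinite antichain, then for
every arity a single lattice term yields all monotone functions. -/
theorem exists_universal_term {L : Type*} [Lattice L] [BoundedOrder L]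
    (hopc : ∀ (n : ℕ) (f : (Fin n → L) → L), Monotone f → IsPolyFn L n f)
    {m : ℕ} {a : ℕ → Fin m → L} (ha : ∀ i j, a i ≤ a j → i = j) (n : ℕ) :
    ∃ (k : ℕ) (t : LatticeTerm (Fin n ⊕ Fin k)), ∀ f : (Fin n → L) → L, Monotone f →
      ∃ c : Fin k → L, ∀ x, f x = t.eval (Sum.elim x c) := by
  by_contra! hcon
  choose f hf hne using hcon
  obtain ⟨e, he⟩ := exists_injective_nat (Σ k, LatticeTerm (Fin n ⊕ Fin k))
  obtain ⟨g, hg, hga⟩ := exists_monotone_glue (a := fun s => a (e s))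
    (fun i j h => he (ha _ _ h)) (f := fun s => f s.1 s.2) (fun s => hf s.1 s.2)
  obtain ⟨k, t, c, ht⟩ := (hopc (n + m)
    (fun z => g (fun i => z (Fin.castAdd m i), fun i => z (Fin.natAdd n i)))
    (fun z z' h => hg ⟨fun i => h _, fun i => h _⟩)).exists_term
  let ρ : Fin (n + m) ⊕ Fin k → Fin n ⊕ Fin (m + k) :=
    Sum.elim (Fin.addCases Sum.inl fun i => Sum.inr (Fin.castAdd k i))
      fun i => Sum.inr (Fin.natAdd m i)
  let y := a (e ⟨m + k, t.map ρ⟩)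
  obtain ⟨x, hx⟩ := hne (m + k) (t.map ρ) (Fin.append y c)
  apply hx
  have hρ : Sum.elim x (Fin.append y c) ∘ ρ = Sum.elim (Fin.append x y) c := by
    ext (i | i)
    · refine Fin.addCases (fun i => ?_) (fun i => ?_) i <;> simp [ρ]
    · simp [ρ]
  rw [LatticeTerm.eval_map, hρ, ← ht]
  simp only [Fin.append_left, Fin.append_right]
  exact (hga ⟨m + k, t.map ρ⟩ x).symm

/-- Uncountably many pairwise incomparable monotone functions yield an infinite antichain in
a finite power, formed by the constants occurring in polynomial representations. -/
theorem exists_antichain_of_uncountable {L : Type*} [Lattice L]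
    (hopc : ∀ (n : ℕ) (f : (Fin n → L) → L), Monotone f → IsPolyFn L n f)
    {ι : Type*} [Uncountable ι] {n : ℕ} {f : ι → (Fin n → L) → L} (hf : ∀ i, Monotone (f i))
    (hinc : ∀ i j, f i ≤ f j → i = j) :
    ∃ (m : ℕ) (a : ℕ → Fin m → L), ∀ i j, a i ≤ a j → i = j := by
  choose k t c h using fun i => (hopc n (f i) (hf i)).exists_term
  let F : ι → Σ k, LatticeTerm (Fin n ⊕ Fin k) := fun i => ⟨k i, t i⟩
  obtain ⟨⟨l, s⟩, hs⟩ : ∃ s, Infinite (F ⁻¹' {s}) := by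
    by_contra! hfin
    have : (Set.univ : Set ι).Countable := by
      rw [← Set.preimage_univ (f := F), ← Set.biUnion_of_singleton Set.univ,
        Set.preimage_iUnion₂]
      refine Set.Countable.biUnion (Set.to_countable _) fun s _ => ?_
      have := hfin s
      exact Set.to_countable _
    exact Set.not_countable_univ this
  have hd : ∀ i : F ⁻¹' {⟨l, s⟩}, ∃ d : Fin l → L, ∀ x, f i x = s.eval (Sum.elim x d) := by
    rintro ⟨i, hi⟩
    have hi : F i = ⟨l, s⟩ := hi
    have key : ∀ q : Σ k, LatticeTerm (Fin n ⊕ Fin k), F i = q →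
        ∃ d : Fin q.1 → L, ∀ x, f i x = q.2.eval (Sum.elim x d) := by
      rintro _ rfl
      exact ⟨c i, h i⟩
    exact key _ hi
  choose d hd using hd
  let e := Infinite.natEmbedding (F ⁻¹' {⟨l, s⟩})
  refine ⟨l, fun i => d (e i), fun i j hij => e.injective (Subtype.ext (hinc _ _ fun x => ?_))⟩
  rw [hd, hd]
  apply s.eval_mono
  rintro (b | b)
  · exact le_rfl
  · exact hij b

theorem exists_antichain_of_strictMono {L : Type*} [Lattice L] [BoundedOrder L]
    (hopc : ∀ (n : ℕ) (f : (Fin n → L) → L), Monotone f → IsPolyFn L n f)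
    {a : ℕ → L} (ha : StrictMono a) :
    ∃ (m : ℕ) (b : ℕ → Fin m → L), ∀ i j, b i ≤ b j → i = j := by
  classical
  let u : Set ℕ → ℕ → ℕ := fun X n =>
    2 * n + if (n % 2 = 1 ↔ (n - 1) / 2 ∈ X) then 1 else 0
  have hu : ∀ X, Monotone (u X) := by
    intro X
    refine monotone_nat_of_le_succ fun n => ?_
    simp only [u]
    split_ifs <;> omega
  let f : Set ℕ → (Fin 1 → L) → L := fun X x =>
    if h : ∃ i, ¬ a i ≤ x 0 then a (u X (Nat.find h)) else ⊤
  have hfa : ∀ X n, f X (fun _ => a n) = a (u X (n + 1)) := by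
    intro X n
    have h : ∃ i, ¬ a i ≤ a n := ⟨n + 1, by simp [ha.le_iff_le]⟩
    have hn : Nat.find h = n + 1 := by
      rw [Nat.find_eq_iff]
      simp only [ha.le_iff_le, not_le, not_lt]
      exact ⟨Nat.lt_succ_self n, fun _ => Nat.le_of_lt_succ⟩
    simp only [f, dif_pos h, hn]
  have : Uncountable (Set ℕ) := by
    rw [← Cardinal.aleph0_lt_mk_iff, Cardinal.mk_set, Cardinal.mk_nat]
    exact Cardinal.cantor _
  refine exists_antichain_of_uncountable hopc (f := f) ?_ ?_
  · intro X x y hxy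
    by_cases hy : ∃ i, ¬ a i ≤ y 0
    · have hx : ∃ i, ¬ a i ≤ x 0 := hy.imp fun i hi h => hi (h.trans (hxy 0))
      simp only [f, dif_pos hx, dif_pos hy]
      exact ha.monotone (hu X (Nat.find_mono fun i hi h => hi (h.trans (hxy 0))))
    · simp only [f, dif_neg hy, le_top]
  · intro X Y hXY
    have key : ∀ n, u X (n + 1) ≤ u Y (n + 1) := by
      intro n
      have := hXY fun _ => a n
      rwa [hfa, hfa, ha.le_iff_le] at this
    ext i
    have h₀ := key (2 * i)
    have h₁ := key (2 * i + 1)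
    have e₀ : (2 * i + 1 - 1) / 2 = i := by omega
    have e₁ : (2 * i + 1 + 1 - 1) / 2 = i := by omega
    have p₀ : (2 * i + 1) % 2 = 1 := by omega
    have p₁ : (2 * i + 1 + 1) % 2 = 0 := by omega
    simp only [u, e₀, e₁, p₀, p₁] at h₀ h₁
    by_cases hX : i ∈ X <;> by_cases hY : i ∈ Y <;> simp_all

theorem exists_antichain_of_infinite {L : Type*} [Lattice L] [BoundedOrder L] [Infinite L]
    (hopc : ∀ (n : ℕ) (f : (Fin n → L) → L), Monotone f → IsPolyFn L n f) :
    ∃ (m : ℕ) (a : ℕ → Fin m → L), ∀ i j, a i ≤ a j → i = j := by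
  let e := Infinite.natEmbedding L
  obtain ⟨g, hg | hg⟩ := exists_increasing_or_nonincreasing_subseq (· < ·) e
  · exact exists_antichain_of_strictMono hopc (a := e ∘ g) fun m n h => hg m n h
  obtain ⟨g', hg' | hg'⟩ := exists_increasing_or_nonincreasing_subseq (· > ·) (e ∘ g)
  · obtain ⟨m, b, hb⟩ := exists_antichain_of_strictMono (L := Lᵒᵈ)
      (fun n f hf => (hopc n f fun x y h => hf (a := y) (b := x) h).dual)
      (a := fun n => OrderDual.toDual (e (g (g' n)))) fun m n h => hg' m n h
    exact ⟨m, b, fun i j h => (hb j i h).symm⟩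
  · refine ⟨1, fun i _ => e (g (g' i)), fun i j h => ?_⟩
    have h0 : e (g (g' i)) ≤ e (g (g' j)) := h 0
    by_contra hij
    have hlt : e (g (g' i)) < e (g (g' j)) :=
      h0.lt_of_ne fun h => hij (g'.injective (g.injective (e.injective h)))
    rcases lt_or_gt_of_ne hij with h | h
    · exact hg _ _ (g'.strictMono h) hlt
    · exact hg' _ _ h hlt

/-- There is no infinite order-polynomially complete bounded lattice. -/
theorem no_infinite_opc_lattice (L : Type u) [Lattice L] [BoundedOrder L]
    (hopc : ∀ (n : ℕ) (f : (Fin n → L) → L), Monotone f → IsPolyFn L n f) :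
    Finite L := by
  classical
  by_contra hfin
  have : Infinite L := not_finite_iff_infinite.mp hfin
  obtain ⟨m, a, ha⟩ := exists_antichain_of_infinite hopc
  obtain ⟨k, t, ht⟩ := exists_universal_term hopc ha 1
  have hc : ∀ x : L, ∃ c : Fin k → L, ∀ z : Fin 1 → L,
      (if x ≤ z 0 then ⊤ else ⊥) = t.eval (Sum.elim z c) := by
    intro x
    refine ht _ fun z w h => ?_
    by_cases hz : x ≤ z 0
    · simp [hz, hz.trans (h 0)]
    · simp [hz]
  choose c hc using hc
  have hb : ∀ x y, (Fin.cons x (c x) : Fin (k + 1) → L) ≤ Fin.cons y (c y) → x = y := by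
    intro x y h
    rw [Fin.cons_le_cons] at h
    refine le_antisymm h.1 ?_
    by_contra hyx
    have hle : t.eval (Sum.elim (fun _ => x) (c x)) ≤ t.eval (Sum.elim (fun _ => x) (c y)) := by
      apply t.eval_mono
      rintro (i | i)
      · exact le_rfl
      · exact h.2 i
    rw [← hc, ← hc, if_pos le_rfl, if_neg hyx] at hle
    exact bot_ne_top (le_antisymm bot_le hle)
  obtain ⟨l, s, hs⟩ := exists_universal_term hopc ha (k + 1)
  have hd : ∀ S : Set L, ∃ d : Fin l → L, ∀ x,
      (if x ∈ S then ⊤ else ⊥) = s.eval (Sum.elim (Fin.cons x (c x)) d) := by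
    intro S
    obtain ⟨g, hg, hgb⟩ := exists_monotone_glue (P := Unit) hb
      (f := fun x _ => if x ∈ S then (⊤ : L) else ⊥) fun _ _ _ _ => le_rfl
    obtain ⟨d, hd⟩ := hs (fun z => g ((), z)) fun z w h => hg ⟨le_rfl, h⟩
    exact ⟨d, fun x => by rw [← hd, hgb]⟩
  choose d hd using hd
  have hinj : Function.Injective d := by
    intro S T h
    ext x
    have := (hd S x).trans ((congrArg (fun d => s.eval (Sum.elim _ d)) h).trans (hd T x).symm)
    by_cases hS : x ∈ S <;> by_cases hT : x ∈ T <;> simp_all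
  have hle := Cardinal.mk_le_of_injective hinj
  rw [Cardinal.mk_set] at hle
  have hpow : Cardinal.mk (Fin l → L) ≤ Cardinal.mk L := by
    simp only [Cardinal.mk_arrow, Cardinal.mk_fin, Cardinal.lift_natCast, Cardinal.lift_uzero]
    exact Cardinal.power_nat_le (Cardinal.aleph0_le_mk L)
  exact absurd (hle.trans hpow) (Cardinal.cantor _).not_ge
end

section
/- For every bounded lattice L there is a bounded lattice L̄ which is σ-saturated and has the countable interpolation property (σ-IP), such that L is a bounded sublattice of L̄. In particular, the σ-IP does not imply σ-completeness. -/
universe u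

/-- `e` is a bounded lattice embedding: an injective map preserving `⊔`, `⊓`, `⊥`, `⊤`. -/
def IsBddLatticeEmbedding {L M : Type u} [Lattice L] [BoundedOrder L]
    [Lattice M] [BoundedOrder M] (e : L → M) : Prop :=
  Function.Injective e ∧ (∀ x y, e (x ⊔ y) = e x ⊔ e y) ∧
    (∀ x y, e (x ⊓ y) = e x ⊓ e y) ∧ e ⊥ = ⊥ ∧ e ⊤ = ⊤

/-- `M` has the countable interpolation property (σ-IP). -/
def HasSigmaIP (M : Type u) [Lattice M] [BoundedOrder M] : Prop :=
  ∀ (n : ℕ) (f : (Fin n → M) → M), Monotone f →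
    ∀ S : Set (Fin n → M), S.Countable →
      ∃ p, IsPolyFn M n p ∧ ∀ a ∈ S, p a = f a

/-- `M` is σ-saturated: whenever `A < B` are countable subsets, `A` upward directed and
`B` downward directed, then some element lies strictly between `A` and `B`. -/
def SigmaSaturated (M : Type u) [Lattice M] : Prop :=
  ∀ A B : Set M, A.Nonempty → B.Nonempty → A.Countable → B.Countable →
    DirectedOn (· ≤ ·) A → DirectedOn (· ≥ ·) B →
    (∀ a ∈ A, ∀ b ∈ B, a < b) →
    ∃ c : M, (∀ a ∈ A, a < c) ∧ ∀ b ∈ B, c < b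

/-- `M` is σ-complete: every countable subset has a least upper bound and a greatest
lower bound. -/
def SigmaComplete (M : Type u) [Lattice M] : Prop :=
  ∀ S : Set M, S.Countable → (∃ a, IsLUB S a) ∧ ∃ a, IsGLB S a

/-- The lattice term `((y ⊔ e) ⊓ g) ⊔ ((y ⊔ e) ⊓ h)`. -/
def closureTerm {K : Type u} [Lattice K] (e g h y : K) : K :=
  ((y ⊔ e) ⊓ g) ⊔ ((y ⊔ e) ⊓ h)

/-- The lattice term with constants `d`, `c` used to interpolate monotone functions. -/
def interpTerm {K : Type u} [Lattice K] [BoundedOrder K] {n : ℕ} (d : Fin n → K) (c : Fin 7 → K)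
    (x : Fin n → K) : K :=
  closureTerm (c 4) (c 5) (c 6)
    (closureTerm (c 0) (c 1) (c 2) (Finset.univ.sup fun i => x i ⊓ d i) ⊓ c 3)

theorem map_closureTerm {K M : Type u} [Lattice K] [BoundedOrder K] [Lattice M] [BoundedOrder M]
    (φ : BoundedLatticeHom K M) (e g h y : K) :
    φ (closureTerm e g h y) = closureTerm (φ e) (φ g) (φ h) (φ y) := by
  simp [closureTerm]

theorem map_interpTerm {K M : Type u} [Lattice K] [BoundedOrder K] [Lattice M] [BoundedOrder M]
    (φ : BoundedLatticeHom K M) {n : ℕ} (d : Fin n → K) (c : Fin 7 → K) (x : Fin n → K) :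
    φ (interpTerm d c x) = interpTerm (φ ∘ d) (φ ∘ c) (φ ∘ x) := by
  simp [interpTerm, map_closureTerm, map_finset_sup, Function.comp_def]

theorem isPolyFn_finset_sup {K : Type u} [Lattice K] [BoundedOrder K] {n : ℕ} {ι : Type*}
    (s : Finset ι) (p : ι → (Fin n → K) → K) (hp : ∀ i, IsPolyFn K n (p i)) :
    IsPolyFn K n fun x => s.sup fun i => p i x := by
  classical
  induction s using Finset.induction_on with
  | empty => simpa using IsPolyFn.const ⊥
  | insert i s _ ih => simpa using (hp i).sup ih

theorem isPolyFn_closureTerm {K : Type u} [Lattice K] {n : ℕ} (e g h : K)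
    {p : (Fin n → K) → K} (hp : IsPolyFn K n p) :
    IsPolyFn K n fun x => closureTerm e g h (p x) :=
  ((hp.sup (.const e)).inf (.const g)).sup ((hp.sup (.const e)).inf (.const h))

theorem isPolyFn_interpTerm {K : Type u} [Lattice K] [BoundedOrder K] {n : ℕ}
    (d : Fin n → K) (c : Fin 7 → K) : IsPolyFn K n (interpTerm d c) :=
  isPolyFn_closureTerm _ _ _ <| .inf (isPolyFn_closureTerm _ _ _ <|
    isPolyFn_finset_sup _ _ fun i => (IsPolyFn.proj i).inf (.const (d i))) (.const _)

section ClosureExtension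

variable (N : Type u) [CompleteLattice N]

/-- Closure operator on `N × N × Set (ClosureOperator N)`: a triple `(a, b, S)` is closed if
`a` and `b` are closed under every operator in `S`, and `S` is everything when `a = b = ⊤`. -/
def flaggedClosure : ClosureOperator (N × N × Set (ClosureOperator N)) :=
  .ofCompletePred
    (fun y => (∀ c ∈ y.2.2, c y.1 = y.1 ∧ c y.2.1 = y.2.1) ∧
      (y.1 = ⊤ → y.2.1 = ⊤ → y.2.2 = Set.univ)) <| by
    intro s hs
    have h1 : ∀ a ∈ s, (sInf s).1 ≤ a.1 := fun a ha => (sInf_le ha : sInf s ≤ a).1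
    have h2 : ∀ a ∈ s, (sInf s).2.1 ≤ a.2.1 := fun a ha => (sInf_le ha : sInf s ≤ a).2.1
    have h3 : ∀ a ∈ s, (sInf s).2.2 ≤ a.2.2 := fun a ha => (sInf_le ha : sInf s ≤ a).2.2
    refine ⟨fun c hc => ⟨le_antisymm ?_ (c.le_closure _), le_antisymm ?_ (c.le_closure _)⟩,
      fun ht ht' => ?_⟩
    · rw [Prod.fst_sInf]
      refine le_sInf ?_
      rintro _ ⟨a, ha, rfl⟩
      rw [← ((hs a ha).1 c (h3 a ha hc)).1, ← Prod.fst_sInf]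
      exact c.monotone (h1 a ha)
    · rw [Prod.snd_sInf, Prod.fst_sInf]
      refine le_sInf ?_
      rintro _ ⟨_, ⟨a, ha, rfl⟩, rfl⟩
      rw [← ((hs a ha).1 c (h3 a ha hc)).2, ← Prod.fst_sInf, ← Prod.snd_sInf]
      exact c.monotone (h2 a ha)
    · have : sInf s = ⊤ := by
        refine sInf_eq_top.2 fun a ha => ?_
        have e1 := top_le_iff.1 (ht ▸ h1 a ha)
        have e2 := top_le_iff.1 (ht' ▸ h2 a ha)
        exact Prod.ext e1 (Prod.ext e2 ((hs a ha).2 e1 e2))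
      rw [this]; rfl

/-- The complete lattice of closed flagged pairs. -/
def ClosureExtension : Type u := (flaggedClosure N).Closeds

noncomputable instance : CompleteLattice (ClosureExtension N) :=
  (flaggedClosure N).gi.liftCompleteLattice

variable {N}

theorem flaggedClosure_isClosed_iff (y : N × N × Set (ClosureOperator N)) :
    (flaggedClosure N).IsClosed y ↔ (∀ c ∈ y.2.2, c y.1 = y.1 ∧ c y.2.1 = y.2.1) ∧
      (y.1 = ⊤ → y.2.1 = ⊤ → y.2.2 = Set.univ) :=
  Iff.rfl

namespace ClosureExtension

/-- The closure of a flagged pair. -/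
def mk (a b : N) (S : Set (ClosureOperator N)) : ClosureExtension N :=
  (flaggedClosure N).toCloseds (a, b, S)

theorem gc : GaloisConnection (fun y => (mk y.1 y.2.1 y.2.2 : ClosureExtension N))
    (fun z => z.1) := (flaggedClosure N).gi.gc

theorem mk_sup_mk (a b a' b' : N) (S S' : Set (ClosureOperator N)) :
    mk a b S ⊔ mk a' b' S' = mk (a ⊔ a') (b ⊔ b') (S ∪ S') :=
  (gc.l_sup (a₁ := (a, b, S)) (a₂ := (a', b', S'))).symm

theorem val_inf (z z' : ClosureExtension N) : (z ⊓ z').1 = z.1 ⊓ z'.1 :=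
  gc.u_inf

theorem mk_val (z : ClosureExtension N) : mk z.1.1 z.1.2.1 z.1.2.2 = z :=
  (flaggedClosure N).gi.l_u_eq z

theorem mk_bot : mk ⊥ ⊥ ∅ = (⊥ : ClosureExtension N) := gc.l_bot

theorem val_mk_of_isClosed {a b : N} {S : Set (ClosureOperator N)}
    (h : (flaggedClosure N).IsClosed (a, b, S)) : (mk a b S).1 = (a, b, S) :=
  h.closure_eq

theorem le_val_mk (a b : N) (S : Set (ClosureOperator N)) : (a, b, S) ≤ (mk a b S).1 :=
  gc.le_u_l (a, b, S)

theorem mk_top (S : Set (ClosureOperator N)) : mk ⊤ ⊤ S = (⊤ : ClosureExtension N) := by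
  have h := le_val_mk (⊤ : N) ⊤ S
  have h1 := top_le_iff.1 h.1
  have h2 := top_le_iff.1 h.2.1
  have h3 := (mk (⊤ : N) ⊤ S).2.2 h1 h2
  refine top_le_iff.1 ?_
  change (⊤ : ClosureExtension N).1 ≤ (mk (⊤ : N) ⊤ S).1
  exact ⟨le_top.trans_eq h1.symm, le_top.trans_eq h2.symm, le_top.trans_eq h3.symm⟩

theorem val_mk_diag (x : N) (hx : x ≠ ⊤) : (mk x x ∅).1 = (x, x, ∅) :=
  val_mk_of_isClosed <| (flaggedClosure_isClosed_iff _).2 ⟨by simp, fun h => absurd h hx⟩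

theorem mk_diag_injective : Function.Injective fun x : N => mk x x ∅ := by
  have key : ∀ x : N, (mk x x ∅).1.1 = x := by
    intro x
    by_cases hx : x = ⊤
    · subst hx
      exact top_le_iff.1 (le_val_mk ⊤ ⊤ ∅).1
    · rw [val_mk_diag x hx]
  intro x y h
  rw [← key x, ← key y]
  exact congrArg (fun z : ClosureExtension N => z.1.1) h

theorem mk_diag_inf (x y : N) : mk (x ⊓ y) (x ⊓ y) ∅ = mk x x ∅ ⊓ mk y y ∅ := by
  by_cases hx : x = ⊤
  · simp [hx, mk_top]
  by_cases hy : y = ⊤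
  · simp [hy, mk_top]
  have hxy : x ⊓ y ≠ ⊤ := fun h => hx (inf_eq_top_iff.1 h).1
  refine Subtype.ext ?_
  rw [val_inf, val_mk_diag _ hx, val_mk_diag _ hy, val_mk_diag _ hxy]
  simp

/-- The diagonal embedding. -/
def diag : BoundedLatticeHom N (ClosureExtension N) where
  toFun x := mk x x ∅
  map_sup' x y := by simp [mk_sup_mk]
  map_inf' := mk_diag_inf
  map_top' := mk_top _
  map_bot' := mk_bot

theorem diag_injective : Function.Injective (diag (N := N)) := mk_diag_injective

theorem mk_inf_eq (c : ClosureOperator N) (x : N) :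
    mk x x {c} ⊓ mk ⊤ ⊥ ∅ = mk (c x) ⊥ ∅ ∧ mk x x {c} ⊓ mk ⊥ ⊤ ∅ = mk ⊥ (c x) ∅ := by
  cases subsingleton_or_nontrivial N with
  | inl _ =>
    have h : ∀ z : ClosureExtension N, z = ⊤ := fun z => by
      rw [← mk_val z, Subsingleton.elim z.1.1 ⊤, Subsingleton.elim z.1.2.1 ⊤, mk_top]
    exact ⟨(h _).trans (h _).symm, (h _).trans (h _).symm⟩
  | inr _ =>
    have h1 : ∀ a : N, (mk a ⊥ ∅).1 = (a, ⊥, ∅) := fun a => val_mk_of_isClosed <|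
      (flaggedClosure_isClosed_iff _).2 ⟨by simp, fun _ h => absurd h bot_ne_top⟩
    have h2 : ∀ a : N, (mk ⊥ a ∅).1 = (⊥, a, ∅) := fun a => val_mk_of_isClosed <|
      (flaggedClosure_isClosed_iff _).2 ⟨by simp, fun h => absurd h bot_ne_top⟩
    have h3 : (mk x x {c}).1.1 = c x ∧ (mk x x {c}).1.2.1 = c x := by
      have hle := le_val_mk x x {c}
      have hcl := (mk x x {c}).2.1 c (hle.2.2 rfl)
      have hge1 : c x ≤ (mk x x {c}).1.1 := hcl.1 ▸ c.monotone hle.1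
      have hge2 : c x ≤ (mk x x {c}).1.2.1 := hcl.2 ▸ c.monotone hle.2.1
      by_cases hx : c x = ⊤
      · rw [hx] at hge1 hge2 ⊢
        exact ⟨top_le_iff.1 hge1, top_le_iff.1 hge2⟩
      · have : (mk x x {c}).1 ≤ (c x, c x, {c}) := by
          refine ClosureOperator.closure_min (c := flaggedClosure N) ?_ ?_
          · exact ⟨c.le_closure x, c.le_closure x, le_rfl⟩
          · exact (flaggedClosure_isClosed_iff _).2 ⟨by simp, fun h => absurd h hx⟩
        exact ⟨this.1.antisymm hge1, this.2.1.antisymm hge2⟩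
    constructor <;> refine Subtype.ext ?_
    · rw [val_inf, h1, h1]
      ext1
      · simp [h3.1]
      · ext1 <;> simp
    · rw [val_inf, h2, h2]
      ext1
      · simp
      · ext1 <;> simp [h3.2]

theorem closureTerm_diag (c : ClosureOperator N) (x : N) :
    closureTerm (mk ⊥ ⊥ {c}) (mk ⊤ ⊥ ∅) (mk ⊥ ⊤ ∅) (diag x) = diag (c x) := by
  have h : diag x ⊔ mk ⊥ ⊥ {c} = mk x x {c} := by
    simp [diag, mk_sup_mk]
  rw [closureTerm, h, (mk_inf_eq c x).1, (mk_inf_eq c x).2, mk_sup_mk]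
  simp [diag]

end ClosureExtension

end ClosureExtension

theorem map_le_iff_of_injective {K M : Type u} [Lattice K] [BoundedOrder K] [Lattice M]
    [BoundedOrder M] (φ : BoundedLatticeHom K M) (hφ : Function.Injective φ) {x y : K} :
    φ x ≤ φ y ↔ x ≤ y := by
  rw [← sup_eq_right, ← map_sup, hφ.eq_iff, sup_eq_right]

theorem map_lt_iff_of_injective {K M : Type u} [Lattice K] [BoundedOrder K] [Lattice M]
    [BoundedOrder M] (φ : BoundedLatticeHom K M) (hφ : Function.Injective φ) {x y : K} :
    φ x < φ y ↔ x < y :=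
  lt_iff_lt_of_le_iff_le' (map_le_iff_of_injective φ hφ) (map_le_iff_of_injective φ hφ)

section Step

variable {X : Type u} [CompleteLattice X]

/-- The closure operator joining `f (a 0, …, a (n - 1))` into the `n`-th coordinate of `a`. -/
def evalClosure {n : ℕ} (f : (Fin n → X) → X) (hf : Monotone f) : ClosureOperator (ℕ → X) :=
  .mk' (fun a k => if k = n then a k ⊔ f (fun i => a i) else a k)
    (fun a b h k => by
      dsimp only
      split_ifs
      · exact sup_le_sup (h k) (hf fun i => h i)
      · exact h k)
    (fun a k => by
      dsimp only
      split_ifs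
      · exact le_sup_left
      · exact le_rfl)
    (fun a k => by
      have h : ∀ i : Fin n, (i : ℕ) ≠ n := fun i => i.2.ne
      by_cases hk : k = n <;> simp [hk, h])

/-- The closure operator joining the `n`-th coordinate into every coordinate. -/
def spreadClosure (X : Type u) [CompleteLattice X] (n : ℕ) : ClosureOperator (ℕ → X) :=
  .mk' (fun a k => a k ⊔ a n) (fun _ _ h k => sup_le_sup (h k) (h n)) (fun _ _ => le_sup_left)
    (fun a k => by simp)

/-- Constant sequences. -/
def constSeq (X : Type u) [CompleteLattice X] : BoundedLatticeHom X (ℕ → X) where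
  toFun x _ := x
  map_sup' _ _ := rfl
  map_inf' _ _ := rfl
  map_top' := rfl
  map_bot' := rfl

/-- The embedding of a complete lattice into the closure extension of its sequences. -/
noncomputable def stepHom (X : Type u) [CompleteLattice X] :
    BoundedLatticeHom X (ClosureExtension (ℕ → X)) :=
  ClosureExtension.diag.comp (constSeq X)

theorem stepHom_injective : Function.Injective (stepHom X) :=
  ClosureExtension.diag_injective.comp fun _ _ h => congrFun h 0

theorem exists_interpTerm_stepHom {n : ℕ} (f : (Fin n → X) → X) (hf : Monotone f) :
    ∃ d c, ∀ x : Fin n → X, interpTerm d c (stepHom X ∘ x) = stepHom X (f x) := by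
  let δ : ℕ → ℕ → X := fun i k => if k = i then ⊤ else ⊥
  refine ⟨fun i => ClosureExtension.diag (δ i), ![.mk ⊥ ⊥ {evalClosure f hf}, .mk ⊤ ⊥ ∅,
    .mk ⊥ ⊤ ∅, ClosureExtension.diag (δ n), .mk ⊥ ⊥ {spreadClosure X n}, .mk ⊤ ⊥ ∅,
    .mk ⊥ ⊤ ∅], fun x => ?_⟩
  have h1 : (Finset.univ.sup fun i : Fin n => (stepHom X ∘ x) i ⊓ ClosureExtension.diag (δ i)) =
      ClosureExtension.diag (Finset.univ.sup fun i : Fin n => (constSeq X (x i)) ⊓ δ i) := by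
    simp [map_finset_sup, Function.comp_def, stepHom]
  have h2 : ∀ j : Fin n,
      (Finset.univ.sup fun i : Fin n => (constSeq X (x i)) ⊓ δ i) j = x j := by
    intro j
    rw [Finset.sup_apply]
    refine le_antisymm (Finset.sup_le fun i _ => ?_) ?_
    · by_cases hij : i = j
      · subst hij; exact inf_le_left
      · have : (j : ℕ) ≠ i := fun h => hij (Fin.ext h.symm)
        simp [δ, this]
    · refine le_trans ?_ (Finset.le_sup (f := fun i : Fin n => (constSeq X (x i) ⊓ δ i) (j : ℕ))
        (Finset.mem_univ j))
      simp [δ, constSeq]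
  have h3 : (Finset.univ.sup fun i : Fin n => (constSeq X (x i)) ⊓ δ i) n = ⊥ := by
    rw [Finset.sup_apply]
    refine (Finset.sup_eq_bot_iff _ _).2 fun i _ => ?_
    simp [δ, i.2.ne']
  unfold interpTerm
  simp only [h1]
  generalize (Finset.univ.sup fun i : Fin n => (constSeq X (x i)) ⊓ δ i) = v at h2 h3
  change closureTerm (.mk ⊥ ⊥ {spreadClosure X n}) (.mk ⊤ ⊥ ∅) (.mk ⊥ ⊤ ∅)
    (closureTerm (.mk ⊥ ⊥ {evalClosure f hf}) (.mk ⊤ ⊥ ∅) (.mk ⊥ ⊤ ∅)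
      (ClosureExtension.diag v) ⊓ ClosureExtension.diag (δ n)) =
    ClosureExtension.diag (constSeq X (f x))
  rw [ClosureExtension.closureTerm_diag, ← map_inf, ClosureExtension.closureTerm_diag]
  congr 1
  funext k
  change (if k = n then v k ⊔ f (fun i => v i) else v k) ⊓ (if k = n then ⊤ else ⊥) ⊔
    (if n = n then v n ⊔ f (fun i => v i) else v n) ⊓ (if n = n then ⊤ else ⊥) = f x
  have hv : (fun i : Fin n => v i) = x := funext h2
  by_cases hk : k = n <;> simp [hk, h3, hv]

theorem exists_between_stepHom {x y : X} (h : x < y) :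
    ∃ z, stepHom X x < z ∧ z < stepHom X y := by
  have hmono : StrictMono (ClosureExtension.diag (N := ℕ → X)) :=
    (OrderHomClass.mono _).strictMono_of_injective ClosureExtension.diag_injective
  refine ⟨ClosureExtension.diag (fun k => if k = 0 then x else y), hmono ?_, hmono ?_⟩
  · refine Pi.lt_def.2 ⟨fun k => ?_, 1, h⟩
    by_cases hk : k = 0 <;> simp [hk, constSeq, h.le]
  · refine Pi.lt_def.2 ⟨fun k => ?_, 0, h⟩
    by_cases hk : k = 0 <;> simp [hk, constSeq, h.le]

end Step

section DirectLimitLattice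

variable {G : ℕ → Type u} [∀ i, Lattice (G i)] [∀ i, BoundedOrder (G i)]
  (f : ∀ i j, i ≤ j → BoundedLatticeHom (G i) (G j)) [DirectedSystem G (f · · ·)]

/-- The direct limit of a sequence of bounded lattices. -/
def LatticeLimit : Type u := DirectLimit G f

variable {f} in
/-- The class of an element of the `i`-th lattice in the direct limit. -/
def LatticeLimit.mk (i : ℕ) (x : G i) : LatticeLimit f := (⟦⟨i, x⟩⟧ : DirectLimit G f)

variable {f} in
@[elab_as_elim]
theorem LatticeLimit.induction {C : LatticeLimit f → Prop} (ih : ∀ i x, C (.mk i x))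
    (x : LatticeLimit f) : C x :=
  DirectLimit.induction f ih x

variable {f} in
@[elab_as_elim]
theorem LatticeLimit.induction₂ {C : LatticeLimit f → LatticeLimit f → Prop}
    (ih : ∀ i x y, C (.mk i x) (.mk i y)) (x y : LatticeLimit f) : C x y :=
  DirectLimit.induction₂ f ih x y

variable {f} in
@[elab_as_elim]
theorem LatticeLimit.induction₃ {C : LatticeLimit f → LatticeLimit f → LatticeLimit f → Prop}
    (ih : ∀ i x y z, C (.mk i x) (.mk i y) (.mk i z)) (x y z : LatticeLimit f) : C x y z :=
  DirectLimit.induction₃ f ih x y z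

noncomputable instance latticeLimitLattice : Lattice (LatticeLimit f) :=
  letI : Max (LatticeLimit f) :=
    ⟨DirectLimit.map₂ f f f (fun _ => (· ⊔ ·)) fun _ _ _ _ _ => map_sup _ _ _⟩
  letI : Min (LatticeLimit f) :=
    ⟨DirectLimit.map₂ f f f (fun _ => (· ⊓ ·)) fun _ _ _ _ _ => map_inf _ _ _⟩
  have hsup : ∀ i (x y : G i),
      (LatticeLimit.mk i x ⊔ LatticeLimit.mk i y : LatticeLimit f) = .mk i (x ⊔ y) :=
    fun _ _ _ => DirectLimit.map₂_def ..
  have hinf : ∀ i (x y : G i),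
      (LatticeLimit.mk i x ⊓ LatticeLimit.mk i y : LatticeLimit f) = .mk i (x ⊓ y) :=
    fun _ _ _ => DirectLimit.map₂_def ..
  Lattice.mk'
    (LatticeLimit.induction₂ fun i x y => by rw [hsup, hsup, sup_comm])
    (LatticeLimit.induction₃ fun i x y z => by rw [hsup, hsup, hsup, hsup, sup_assoc])
    (LatticeLimit.induction₂ fun i x y => by rw [hinf, hinf, inf_comm])
    (LatticeLimit.induction₃ fun i x y z => by rw [hinf, hinf, hinf, hinf, inf_assoc])
    (LatticeLimit.induction₂ fun i x y => by rw [hinf, hsup, sup_inf_self])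
    (LatticeLimit.induction₂ fun i x y => by rw [hsup, hinf, inf_sup_self])

theorem LatticeLimit.mk_sup (i : ℕ) (x y : G i) :
    (LatticeLimit.mk i x ⊔ LatticeLimit.mk i y : LatticeLimit f) = .mk i (x ⊔ y) :=
  DirectLimit.map₂_def ..

theorem LatticeLimit.mk_inf (i : ℕ) (x y : G i) :
    (LatticeLimit.mk i x ⊓ LatticeLimit.mk i y : LatticeLimit f) = .mk i (x ⊓ y) :=
  DirectLimit.map₂_def ..

theorem LatticeLimit.mk_top (i : ℕ) :
    (LatticeLimit.mk i ⊤ : LatticeLimit f) = .mk 0 ⊤ := by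
  rw [← map_top (f 0 i i.zero_le)]
  exact DirectLimit.mk_apply (f := f) 0 i ⊤ i.zero_le

theorem LatticeLimit.mk_bot (i : ℕ) :
    (LatticeLimit.mk i ⊥ : LatticeLimit f) = .mk 0 ⊥ := by
  rw [← map_bot (f 0 i i.zero_le)]
  exact DirectLimit.mk_apply (f := f) 0 i ⊥ i.zero_le

noncomputable instance latticeLimitBoundedOrder : BoundedOrder (LatticeLimit f) where
  top := .mk 0 ⊤
  le_top := LatticeLimit.induction fun i x => by
    rw [← LatticeLimit.mk_top f i, ← sup_eq_right, LatticeLimit.mk_sup, sup_top_eq]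
  bot := .mk 0 ⊥
  bot_le := LatticeLimit.induction fun i x => by
    rw [← LatticeLimit.mk_bot f i, ← sup_eq_right, LatticeLimit.mk_sup, bot_sup_eq]

/-- The canonical map into the direct limit. -/
noncomputable def LatticeLimit.of (i : ℕ) : BoundedLatticeHom (G i) (LatticeLimit f) where
  toFun x := .mk i x
  map_sup' x y := (LatticeLimit.mk_sup f i x y).symm
  map_inf' x y := (LatticeLimit.mk_inf f i x y).symm
  map_top' := LatticeLimit.mk_top f i
  map_bot' := LatticeLimit.mk_bot f i

theorem LatticeLimit.of_comp {i j : ℕ} (h : i ≤ j) (x : G i) :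
    LatticeLimit.of f j (f i j h x) = LatticeLimit.of f i x :=
  DirectLimit.mk_apply (f := f) i j x h

theorem LatticeLimit.of_injective (hf : ∀ i j h, Function.Injective (f i j h)) (i : ℕ) :
    Function.Injective (LatticeLimit.of f i) :=
  DirectLimit.mk_injective f hf i

theorem LatticeLimit.exists_of_eq {ι : Type*} [Fintype ι] (z : ι → LatticeLimit f) :
    ∃ m, ∃ y : ι → G m, ∀ i, LatticeLimit.of f m (y i) = z i := by
  choose lv y hy using fun i => DirectLimit.exists_eq_mk f (z i)
  refine ⟨Finset.univ.sup lv, fun i => f _ _ (Finset.le_sup (Finset.mem_univ i)) (y i),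
    fun i => ?_⟩
  rw [LatticeLimit.of_comp, hy]
  rfl

end DirectLimitLattice

section Tower

variable (X : Type u) [CompleteLattice X]

/-- Iterated closure extensions. -/
noncomputable def tower : ℕ → CompleteLat.{u}
  | 0 => .of X
  | n + 1 => .of (ClosureExtension (ℕ → tower n))

/-- The transition maps of the tower. -/
noncomputable def towerMap (i j : ℕ) (h : i ≤ j) : BoundedLatticeHom (tower X i) (tower X j) :=
  Nat.leRecOn (C := fun j => BoundedLatticeHom (tower X i) (tower X j)) h
    (fun {j} φ => (stepHom (tower X j)).comp φ) (BoundedLatticeHom.id _)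

theorem towerMap_self (i : ℕ) : towerMap X i i le_rfl = BoundedLatticeHom.id _ :=
  Nat.leRecOn_self _

theorem towerMap_succ {i j : ℕ} (h : i ≤ j) :
    towerMap X i (j + 1) (h.trans j.le_succ) = (stepHom (tower X j)).comp (towerMap X i j h) :=
  Nat.leRecOn_succ (C := fun j => BoundedLatticeHom (tower X i) (tower X j)) h _

theorem towerMap_step (i : ℕ) : towerMap X i (i + 1) i.le_succ = stepHom (tower X i) := by
  rw [towerMap_succ X le_rfl, towerMap_self]
  rfl

theorem towerMap_injective (i j : ℕ) (h : i ≤ j) : Function.Injective (towerMap X i j h) := by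
  induction j, h using Nat.le_induction with
  | base => rw [towerMap_self]; exact Function.injective_id
  | succ j h ih => rw [towerMap_succ X h]; exact stepHom_injective.comp ih

instance : DirectedSystem (fun i => tower X i) (towerMap X · · ·) where
  map_self i x := by rw [towerMap_self]; rfl
  map_map k j i hij hjk x := by
    induction k, hjk using Nat.le_induction with
    | base => rw [towerMap_self]; rfl
    | succ k hjk ih =>
      rw [towerMap_succ X hjk, towerMap_succ X (hij.trans hjk)]
      exact congrArg (stepHom (tower X k)) ih

/-- The union of the tower. -/
abbrev TowerLimit : Type u := LatticeLimit (towerMap X)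

theorem latticeLimit_of_step (m : ℕ) (x : tower X m) :
    LatticeLimit.of (towerMap X) (m + 1) (stepHom _ x) = LatticeLimit.of (towerMap X) m x := by
  rw [← towerMap_step]
  exact LatticeLimit.of_comp (towerMap X) _ x

end Tower

/-- Finite interpolation by a term whose shape depends only on the arity. -/
def UniformFiniteIP (K : Type u) [Lattice K] [BoundedOrder K] : Prop :=
  ∀ (n N : ℕ) (a : ℕ → Fin n → K) (b : ℕ → K),
    (∀ i < N, ∀ j < N, a i ≤ a j → b i ≤ b j) →
      ∃ d c, ∀ i < N, interpTerm d c (a i) = b i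

theorem exists_interpTerm_of_comp_stepHom {X K : Type u} [CompleteLattice X] [Lattice K]
    [BoundedOrder K] (φ : BoundedLatticeHom X K) (hφ : Function.Injective φ)
    (ψ : BoundedLatticeHom (ClosureExtension (ℕ → X)) K) (hψ : ∀ x, ψ (stepHom X x) = φ x)
    {n N : ℕ} (α : Fin N → Fin n → X) (β : Fin N → X)
    (hαβ : ∀ i j, φ ∘ α i ≤ φ ∘ α j → φ (β i) ≤ φ (β j)) :
    ∃ d c, ∀ i, interpTerm d c (φ ∘ α i) = φ (β i) := by
  let F : (Fin n → X) → X := fun x => ⨆ i, ⨆ _ : α i ≤ x, β i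
  have hF : Monotone F := fun x x' h =>
    iSup_mono fun i => iSup_le fun hi => le_iSup_of_le (hi.trans h) le_rfl
  have hFα : ∀ i, F (α i) = β i := fun i => by
    refine le_antisymm (iSup₂_le fun j hj => ?_) (le_iSup₂_of_le i le_rfl le_rfl)
    exact (map_le_iff_of_injective φ hφ).1
      (hαβ j i fun k => (map_le_iff_of_injective φ hφ).2 (hj k))
  obtain ⟨d, c, hdc⟩ := exists_interpTerm_stepHom F hF
  refine ⟨ψ ∘ d, ψ ∘ c, fun i => ?_⟩
  have h := congrArg ψ (hdc (α i))
  rw [map_interpTerm, hψ, hFα] at h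
  rw [← h]
  exact congrArg _ (funext fun j => (hψ _).symm)

theorem uniformFiniteIP_tower (X : Type u) [CompleteLattice X] :
    UniformFiniteIP (TowerLimit X) := by
  intro n N a b hab
  obtain ⟨m, y, hy⟩ := LatticeLimit.exists_of_eq (towerMap X)
    (Sum.elim (fun p : Fin N × Fin n => a p.1 p.2) fun i : Fin N => b i)
  have hα : ∀ i : Fin N, LatticeLimit.of (towerMap X) m ∘ (fun j => y (.inl (i, j))) = a i :=
    fun i => funext fun j => hy (.inl (i, j))
  have hβ : ∀ i : Fin N, LatticeLimit.of (towerMap X) m (y (.inr i)) = b i :=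
    fun i => hy (.inr i)
  obtain ⟨d, c, hdc⟩ := exists_interpTerm_of_comp_stepHom (LatticeLimit.of (towerMap X) m)
    (LatticeLimit.of_injective (towerMap X) (towerMap_injective X) m)
    (LatticeLimit.of (towerMap X) (m + 1)) (latticeLimit_of_step X m)
    (fun i j => y (.inl (i, j))) (fun i => y (.inr i)) (fun i j h => by
      rw [hα, hα] at h
      rw [hβ, hβ]
      exact hab i i.2 j j.2 h)
  refine ⟨d, c, fun i hi => ?_⟩
  rw [← hβ ⟨i, hi⟩, ← hα ⟨i, hi⟩]
  exact hdc ⟨i, hi⟩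

theorem exists_between_tower (X : Type u) [CompleteLattice X]
    {x y : TowerLimit X} (h : x < y) : ∃ z, x < z ∧ z < y := by
  obtain ⟨m, u, hu⟩ := LatticeLimit.exists_of_eq (towerMap X) ![x, y]
  have hinj := LatticeLimit.of_injective (towerMap X) (towerMap_injective X)
  have hx : LatticeLimit.of (towerMap X) m (u 0) = x := hu 0
  have hy : LatticeLimit.of (towerMap X) m (u 1) = y := hu 1
  rw [← hx, ← hy, map_lt_iff_of_injective _ (hinj m)] at h
  obtain ⟨z, hz, hz'⟩ := exists_between_stepHom h
  refine ⟨LatticeLimit.of (towerMap X) (m + 1) z, ?_, ?_⟩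
  · rw [← hx, ← latticeLimit_of_step]
    exact (map_lt_iff_of_injective _ (hinj (m + 1))).2 hz
  · rw [← hy, ← latticeLimit_of_step]
    exact (map_lt_iff_of_injective _ (hinj (m + 1))).2 hz'

section Ultrapower

open Filter

theorem exists_diagonal_of_eventually {C : Type*} (Q : ℕ → ℕ → C → Prop)
    (h : ∀ N, ∀ᶠ k in (hyperfilter ℕ : Filter ℕ), ∃ c, ∀ i < N, Q i k c) :
    ∃ c : ℕ → C, ∀ i, ∀ᶠ k in (hyperfilter ℕ : Filter ℕ), Q i k (c k) := by
  classical
  have hne : Nonempty C := by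
    obtain ⟨_, c, _⟩ := (h 0).exists
    exact ⟨c⟩
  let P : ℕ → ℕ → Prop := fun k N => ∃ c, ∀ i < N, Q i k c
  have hP0 : ∀ k, P k 0 := fun k => ⟨hne.some, fun i hi => absurd hi i.not_lt_zero⟩
  choose c hc using fun k => Nat.findGreatest_spec (P := P k) (Nat.zero_le k) (hP0 k)
  refine ⟨c, fun i => ?_⟩
  have hge : ∀ᶠ k in (hyperfilter ℕ : Filter ℕ), i + 1 ≤ k :=
    (Nat.hyperfilter_le_atTop (eventually_ge_atTop (i + 1)))
  filter_upwards [h (i + 1), hge] with k hk hik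
  exact hc k i (Nat.le_findGreatest hik hk)

/-- The hyperfilter ultrapower indexed by the natural numbers. -/
abbrev NatUltrapower (K : Type u) : Type u := Germ (hyperfilter ℕ : Filter ℕ) K

theorem natUltrapower_exists_rep {K : Type u} (g : NatUltrapower K) :
    ∃ f : ℕ → K, (f : NatUltrapower K) = g :=
  Quotient.exists_rep g

variable {K : Type u} [Lattice K]

theorem sigmaSaturated_natUltrapower (hK : ∀ x y : K, x < y → ∃ z, x < z ∧ z < y) :
    SigmaSaturated (NatUltrapower K) := by
  intro A B hA hB hAc hBc hAd hBd hAB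
  obtain ⟨a, rfl⟩ := hAc.exists_eq_range hA
  obtain ⟨b, rfl⟩ := hBc.exists_eq_range hB
  have hub : ∀ N : ℕ, ∃ u, ∀ i < N, a i ≤ a u := by
    intro N
    induction N with
    | zero => exact ⟨0, by simp⟩
    | succ N ih =>
      obtain ⟨u, hu⟩ := ih
      obtain ⟨_, ⟨v, rfl⟩, h1, h2⟩ := hAd _ ⟨u, rfl⟩ _ ⟨N, rfl⟩
      refine ⟨v, fun i hi => ?_⟩
      obtain h | rfl := Nat.lt_succ_iff_lt_or_eq.1 hi
      · exact (hu i h).trans h1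
      · exact h2
  have hlb : ∀ N : ℕ, ∃ u, ∀ i < N, b u ≤ b i := by
    intro N
    induction N with
    | zero => exact ⟨0, by simp⟩
    | succ N ih =>
      obtain ⟨u, hu⟩ := ih
      obtain ⟨_, ⟨v, rfl⟩, h1, h2⟩ := hBd _ ⟨u, rfl⟩ _ ⟨N, rfl⟩
      refine ⟨v, fun i hi => ?_⟩
      obtain h | rfl := Nat.lt_succ_iff_lt_or_eq.1 hi
      · exact le_trans h1 (hu i h)
      · exact h2
  choose α hα using fun i => natUltrapower_exists_rep (a i)
  choose β hβ using fun i => natUltrapower_exists_rep (b i)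
  obtain ⟨c, hc⟩ := exists_diagonal_of_eventually
    (fun i k (c : K) => α i k < c ∧ c < β i k) (fun N => by
    obtain ⟨u, hu⟩ := hub N
    obtain ⟨v, hv⟩ := hlb N
    have h1 : ∀ᶠ k in (hyperfilter ℕ : Filter ℕ), ∀ i ∈ Set.Iio N, α i k ≤ α u k :=
      (Set.finite_Iio N).eventually_all.2 fun i hi => by
        have := hu i hi
        rwa [← hα, ← hα, Germ.coe_le] at this
    have h2 : ∀ᶠ k in (hyperfilter ℕ : Filter ℕ), ∀ i ∈ Set.Iio N, β v k ≤ β i k :=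
      (Set.finite_Iio N).eventually_all.2 fun i hi => by
        have := hv i hi
        rwa [← hβ, ← hβ, Germ.coe_le] at this
    have h3 : ∀ᶠ k in (hyperfilter ℕ : Filter ℕ), α u k < β v k := by
      have := hAB _ ⟨u, rfl⟩ _ ⟨v, rfl⟩
      rwa [← hα, ← hβ, Germ.coe_lt] at this
    filter_upwards [h1, h2, h3] with k h1 h2 h3
    obtain ⟨z, hz, hz'⟩ := hK _ _ h3
    exact ⟨z, fun i hi => ⟨(h1 i hi).trans_lt hz, hz'.trans_le (h2 i hi)⟩⟩)
  refine ⟨(c : NatUltrapower K), ?_, ?_⟩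
  · rintro _ ⟨i, rfl⟩
    rw [← hα, Germ.coe_lt]
    exact (hc i).mono fun k hk => hk.1
  · rintro _ ⟨i, rfl⟩
    rw [← hβ, Germ.coe_lt]
    exact (hc i).mono fun k hk => hk.2

variable [BoundedOrder K]

/-- The quotient map onto the ultrapower. -/
noncomputable def germHom (K : Type u) [Lattice K] [BoundedOrder K] :
    BoundedLatticeHom (ℕ → K) (NatUltrapower K) where
  toFun f := (f : NatUltrapower K)
  map_sup' _ _ := rfl
  map_inf' _ _ := rfl
  map_top' := rfl
  map_bot' := rfl

/-- The diagonal embedding into the ultrapower. -/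
noncomputable def ultraHom (K : Type u) [Lattice K] [BoundedOrder K] :
    BoundedLatticeHom K (NatUltrapower K) where
  toFun x := ((fun _ => x : ℕ → K) : NatUltrapower K)
  map_sup' _ _ := rfl
  map_inf' _ _ := rfl
  map_top' := rfl
  map_bot' := rfl

theorem ultraHom_injective : Function.Injective (ultraHom K) :=
  fun _ _ h => Germ.const_inj.1 h

theorem interpTerm_apply {n : ℕ} (d : Fin n → ℕ → K) (c : Fin 7 → ℕ → K) (x : Fin n → ℕ → K)
    (k : ℕ) : interpTerm d c x k =
      interpTerm (fun i => d i k) (fun i => c i k) (fun i => x i k) :=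
  map_interpTerm (⟨⟨⟨fun f => f k, fun _ _ => rfl⟩, fun _ _ => rfl⟩, rfl, rfl⟩ :
    BoundedLatticeHom (ℕ → K) K) d c x

theorem hasSigmaIP_natUltrapower (hK : UniformFiniteIP K) : HasSigmaIP (NatUltrapower K) := by
  intro n f hf S hS
  obtain rfl | hne := S.eq_empty_or_nonempty
  · exact ⟨_, .const ⊥, fun a ha => absurd ha (Set.notMem_empty a)⟩
  obtain ⟨a, rfl⟩ := hS.exists_eq_range hne
  choose α hα using fun i j => natUltrapower_exists_rep (a i j)
  choose β hβ using fun i => natUltrapower_exists_rep (f (a i))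
  have hmono : ∀ i j, ∀ᶠ k in (hyperfilter ℕ : Filter ℕ),
      ((fun l => α i l k) ≤ fun l => α j l k) → β i k ≤ β j k := by
    intro i j
    by_cases hij : a i ≤ a j
    · have := hf hij
      rw [← hβ, ← hβ, Germ.coe_le] at this
      exact this.mono fun k hk _ => hk
    · obtain ⟨l, hl⟩ := not_forall.1 hij
      rw [← hα, ← hα, Germ.coe_le] at hl
      exact (Ultrafilter.eventually_not.2 hl).mono fun k hk h => absurd (h l) hk
  obtain ⟨p, hp⟩ := exists_diagonal_of_eventually
    (fun i k (p : (Fin n → K) × (Fin 7 → K)) =>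
      interpTerm p.1 p.2 (fun l => α i l k) = β i k) (fun N => by
    have hall : ∀ᶠ k in (hyperfilter ℕ : Filter ℕ), ∀ i ∈ Set.Iio N, ∀ j ∈ Set.Iio N,
        ((fun l => α i l k) ≤ fun l => α j l k) → β i k ≤ β j k :=
      (Set.finite_Iio N).eventually_all.2 fun i _ =>
        (Set.finite_Iio N).eventually_all.2 fun j _ => hmono i j
    refine hall.mono fun k hk => ?_
    obtain ⟨d, c, hdc⟩ := hK n N (fun i l => α i l k) (fun i => β i k) hk
    exact ⟨(d, c), hdc⟩)
  refine ⟨_, isPolyFn_interpTerm (germHom K ∘ fun l k => (p k).1 l)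
    (germHom K ∘ fun l k => (p k).2 l), ?_⟩
  rintro _ ⟨i, rfl⟩
  have h1 : a i = germHom K ∘ α i := funext fun l => (hα i l).symm
  rw [← hβ i, h1, ← map_interpTerm]
  refine Germ.coe_eq.2 ((hp i).mono fun k hk => ?_)
  rw [interpTerm_apply]
  exact hk

end Ultrapower

/-- The embedding of a bounded lattice into its lattice of ideals. -/
def idealHom (L : Type u) [Lattice L] [BoundedOrder L] :
    BoundedLatticeHom L (Order.Ideal L) where
  toFun := Order.Ideal.principal
  map_sup' x y := by
    refine le_antisymm ?_ ?_
    · exact Order.Ideal.principal_le_iff.2 (Order.Ideal.sup_mem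
        (Order.Ideal.principal_le_iff.1 le_sup_left) (Order.Ideal.principal_le_iff.1 le_sup_right))
    · exact sup_le (Order.Ideal.principal_le_iff.2 le_sup_left)
        (Order.Ideal.principal_le_iff.2 le_sup_right)
  map_inf' x y := by
    ext z
    simp
  map_top' := Order.Ideal.principal_top
  map_bot' := Order.Ideal.principal_bot

theorem idealHom_injective {L : Type u} [Lattice L] [BoundedOrder L] :
    Function.Injective (idealHom L) := fun _ _ h =>
  le_antisymm (Order.Ideal.principal_le_iff.1 (le_of_eq h))
    (Order.Ideal.principal_le_iff.1 (le_of_eq h.symm))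

theorem exists_sigmaSaturated_hasSigmaIP (L : Type u) [Lattice L] [BoundedOrder L] :
    ∃ (M : Type u) (_ : Lattice M) (_ : BoundedOrder M) (e : L → M),
      IsBddLatticeEmbedding e ∧ SigmaSaturated M ∧ HasSigmaIP M := by
  let X := Order.Ideal L
  let φ : BoundedLatticeHom L (NatUltrapower (TowerLimit X)) :=
    ((ultraHom (TowerLimit X)).comp (LatticeLimit.of (towerMap X) 0)).comp (idealHom L)
  have hφ : Function.Injective φ := (ultraHom_injective.comp
    (LatticeLimit.of_injective (towerMap X) (towerMap_injective X) 0)).comp idealHom_injective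
  exact ⟨NatUltrapower (TowerLimit X), inferInstance, inferInstance, φ,
    ⟨hφ, map_sup φ, map_inf φ, map_bot φ, map_top φ⟩,
    sigmaSaturated_natUltrapower fun _ _ => exists_between_tower X,
    hasSigmaIP_natUltrapower (uniformFiniteIP_tower X)⟩

theorem SigmaSaturated.not_sigmaComplete {M : Type u} [Lattice M] [BoundedOrder M]
    [Nontrivial M] (h : SigmaSaturated M) : ¬SigmaComplete M := by
  intro hM
  have hsing : ∀ x : M, DirectedOn (· ≤ ·) {x} ∧ DirectedOn (· ≥ ·) {x} := fun x =>
    ⟨directedOn_singleton x, directedOn_singleton x⟩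
  have : NoMaxOrder (Set.Iio (⊤ : M)) := ⟨fun x => by
    obtain ⟨c, hc, hc'⟩ := h {x.1} {⊤} (Set.singleton_nonempty _) (Set.singleton_nonempty _)
      (Set.countable_singleton _) (Set.countable_singleton _) (hsing _).1 (hsing _).2
      (by rintro _ rfl _ rfl; exact x.2)
    exact ⟨⟨c, hc' _ rfl⟩, hc _ rfl⟩⟩
  have : Nonempty (Set.Iio (⊤ : M)) := ⟨⟨⊥, bot_lt_top⟩⟩
  obtain ⟨a, ha⟩ := Nat.exists_strictMono (Set.Iio (⊤ : M))
  have hcount := Set.countable_range fun i => (a i).1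
  obtain ⟨s, hs⟩ := (hM _ hcount).1
  have hmono : StrictMono fun i => (a i).1 := fun i j hij => ha hij
  obtain ⟨c, hc, hc'⟩ := h _ {s} (Set.range_nonempty fun i => (a i).1)
    (Set.singleton_nonempty _) hcount (Set.countable_singleton _)
    (directedOn_range.2 hmono.monotone.directed_le) (hsing _).2 (by
      rintro _ ⟨i, rfl⟩ _ rfl
      exact (hmono i.lt_succ_self).trans_le (hs.1 ⟨i + 1, rfl⟩))
  exact (hs.2 fun x hx => (hc x hx).le).not_gt (hc' s rfl)

/-- Every bounded lattice `L` embeds as a bounded sublattice into a σ-saturated bounded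
lattice with the countable interpolation property.  In particular, the σ-IP does not
imply σ-completeness. -/
theorem exists_sigma_saturated_sigma_ip_extension (L : Type u) [Lattice L]
    [BoundedOrder L] :
    (∃ (M : Type u) (_ : Lattice M) (_ : BoundedOrder M) (e : L → M),
        IsBddLatticeEmbedding e ∧ SigmaSaturated M ∧ HasSigmaIP M) ∧
    ∃ (M : Type u) (_ : Lattice M) (_ : BoundedOrder M),
      HasSigmaIP M ∧ ¬SigmaComplete M := by
  refine ⟨exists_sigmaSaturated_hasSigmaIP L, ?_⟩
  obtain ⟨M, _, _, e, he, hsat, hip⟩ :=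
    exists_sigmaSaturated_hasSigmaIP (Set PUnit.{u + 1})
  have : Nontrivial M := he.1.nontrivial
  exact ⟨M, _, _, hip, hsat.not_sigmaComplete⟩
end

section
/- For every bounded lattice L there is a bounded lattice L̄ such that L is a bounded sublattice of L̄, L̄ is a complete lattice, every σ-polynomial function on L̄ is total (in fact monotone), and for every k ∈ ℕ every monotone function f : L̄^k → L̄ is a k-ary σ-polynomial function on L̄; thus the monotone functions on L̄ are exactly the σ-polynomial functions. -/
universe u

/-- `IsSigmaPolyFn M k p` says that `p : (Fin k → M) → M` is a `k`-ary σ-polynomial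
function on the complete lattice `M`: it lies in the smallest set of functions containing
the coordinate projections and all constant functions and closed under pointwise suprema
and infima of finite or countably infinite families.  (On a complete lattice all such
functions are total.) -/
inductive IsSigmaPolyFn (M : Type u) [CompleteLattice M] (k : ℕ) :
    ((Fin k → M) → M) → Prop
  | proj (i : Fin k) : IsSigmaPolyFn M k fun x => x i
  | const (c : M) : IsSigmaPolyFn M k fun _ => c
  | iSup {ι : Type} [Countable ι] {p : ι → (Fin k → M) → M} :
      (∀ i, IsSigmaPolyFn M k (p i)) → IsSigmaPolyFn M k fun x => ⨆ i, p i x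
  | iInf {ι : Type} [Countable ι] {p : ι → (Fin k → M) → M} :
      (∀ i, IsSigmaPolyFn M k (p i)) → IsSigmaPolyFn M k fun x => ⨅ i, p i x

/-- Auxiliary generators over a stage `P` of the construction. A closed set containing `probe i`
and `A` contains `trace i A`; a closed set containing `graph k F` and `trace i (a i)` for all
`i < k` contains `F a`. -/
inductive AuxGen (P : Type u) : Type u
  | probe (i : ℕ) : AuxGen P
  | trace (i : ℕ) (A : Set P) : AuxGen P
  | graph (k : ℕ) (F : (Fin k → Set P) → Set P) : AuxGen P

/-- The cumulative stages: two copies of `L`, then repeatedly adjoining auxiliary generators. -/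
def Stage (L : Type u) : ℕ → Type u
  | 0 => Bool × L
  | n + 1 => Stage L n ⊕ AuxGen (Stage L n)

/-- The union of all stages. -/
inductive Gen (L : Type u) : Type u
  | base (b : Bool) (y : L) : Gen L
  | aux (n : ℕ) (s : AuxGen (Stage L n)) : Gen L

namespace Gen

variable {L : Type u}

/-- The inclusion of a stage into the union. -/
def ofStage : ∀ n, Stage L n → Gen L
  | 0, p => base p.1 p.2
  | n + 1, p => Sum.elim (ofStage n) (aux n) p

/-- The generators occurring at stage `n`. -/
def upTo (n : ℕ) : Set (Gen L)
  | base _ _ => True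
  | aux m _ => m < n

@[simp] lemma base_mem_upTo (n : ℕ) (b : Bool) (y : L) : base b y ∈ upTo n := trivial

@[simp] lemma aux_mem_upTo {n m : ℕ} {s : AuxGen (Stage L m)} : aux m s ∈ upTo n ↔ m < n :=
  Iff.rfl

lemma upTo_mono {m n : ℕ} (h : m ≤ n) : (upTo m : Set (Gen L)) ⊆ upTo n := by
  rintro (⟨b, y⟩ | ⟨l, s⟩) hz
  · trivial
  · exact lt_of_lt_of_le hz h

lemma range_ofStage (n : ℕ) : Set.range (ofStage n) = (upTo n : Set (Gen L)) := by
  induction n with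
  | zero =>
    ext z
    rcases z with ⟨b, y⟩ | ⟨l, s⟩
    · exact iff_of_true ⟨(b, y), rfl⟩ trivial
    · refine iff_of_false ?_ (Nat.not_lt_zero l)
      rintro ⟨p, hp⟩
      cases hp
  | succ n ih =>
    have h : Set.range (ofStage (n + 1)) =
        Set.range (ofStage n : Stage L n → Gen L) ∪ Set.range (aux n) :=
      Set.Sum.elim_range _ _
    rw [h, ih]
    ext z
    rcases z with ⟨b, y⟩ | ⟨l, s⟩
    · simp
    · simp only [Set.mem_union, aux_mem_upTo, Set.mem_range, aux.injEq, Nat.lt_succ_iff_lt_or_eq]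
      refine or_congr_right ⟨fun ⟨_, h, _⟩ => h.symm, ?_⟩
      rintro rfl
      exact ⟨s, rfl, HEq.rfl⟩

lemma ofStage_mem_upTo {n : ℕ} (p : Stage L n) : ofStage n p ∈ upTo n :=
  range_ofStage (L := L) n ▸ Set.mem_range_self p

lemma exists_ofStage_eq {n : ℕ} {z : Gen L} (hz : z ∈ upTo n) : ∃ p, ofStage n p = z := by
  rwa [← range_ofStage] at hz

end Gen

open Gen AuxGen

/-- The closed sets of generators. -/
structure IsClosedGen {L : Type u} [Lattice L] [BoundedOrder L] (S : Set (Gen L)) : Prop where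
  bot_mem : ∀ b, base b ⊥ ∈ S
  mem_of_le : ∀ {b y z}, y ≤ z → base b z ∈ S → base b y ∈ S
  sup_mem : ∀ {b y z}, base b y ∈ S → base b z ∈ S → base b (y ⊔ z) ∈ S
  mem_of_top : (∀ b, base b ⊤ ∈ S) → ∀ z, z ∈ S
  mem_of_unbounded : (∀ n, ¬ S ⊆ upTo n) → ∀ z, z ∈ S
  trace_mem : ∀ {n i} {A : Set (Stage L n)}, (∀ p ∈ A, ofStage n p ∈ S) →
    aux n (probe i) ∈ S → aux n (trace i A) ∈ S
  graph_mem : ∀ {n k} {F : (Fin k → Set (Stage L n)) → Set (Stage L n)}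
    {a : Fin k → Set (Stage L n)}, 0 < k → (∀ i : Fin k, aux n (trace i (a i)) ∈ S) →
    aux n (graph k F) ∈ S → ∀ p ∈ F a, ofStage n p ∈ S

/-- The lattice of closed sets of generators. -/
def ClosedGen (L : Type u) [Lattice L] [BoundedOrder L] : Type u :=
  {S : Set (Gen L) // IsClosedGen S}

namespace ClosedGen

variable {L : Type u} [Lattice L] [BoundedOrder L]

instance : PartialOrder (ClosedGen L) := inferInstanceAs (PartialOrder (Subtype _))

lemma le_iff {x y : ClosedGen L} : x ≤ y ↔ x.1 ⊆ y.1 := Iff.rfl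

lemma isClosedGen_sInter {C : Set (Set (Gen L))} (hC : ∀ S ∈ C, IsClosedGen S) :
    IsClosedGen (⋂₀ C) where
  bot_mem b S hS := (hC S hS).bot_mem b
  mem_of_le h hz S hS := (hC S hS).mem_of_le h (hz S hS)
  sup_mem hy hz S hS := (hC S hS).sup_mem (hy S hS) (hz S hS)
  mem_of_top h z S hS := (hC S hS).mem_of_top (fun b => h b S hS) z
  mem_of_unbounded h z S hS :=
    (hC S hS).mem_of_unbounded (fun n hn => h n ((Set.sInter_subset_of_mem hS).trans hn)) z
  trace_mem hA hp S hS := (hC S hS).trace_mem (fun p hpA => hA p hpA S hS) (hp S hS)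
  graph_mem hk ht hg p hp S hS := (hC S hS).graph_mem hk (fun i => ht i S hS) (hg S hS) p hp

instance : InfSet (ClosedGen L) where
  sInf C := ⟨⋂₀ (Subtype.val '' C), isClosedGen_sInter (by rintro _ ⟨x, -, rfl⟩; exact x.2)⟩

noncomputable instance : CompleteLattice (ClosedGen L) :=
  completeLatticeOfInf _ fun C =>
    ⟨fun x hx => Set.sInter_subset_of_mem ⟨x, hx, rfl⟩,
      fun y hy => Set.subset_sInter (by rintro _ ⟨x, hx, rfl⟩; exact hy hx)⟩

/-- The closure of a set of generators. -/
noncomputable def cl (T : Set (Gen L)) : ClosedGen L := sInf {x | T ⊆ x.1}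

lemma cl_le_iff {T : Set (Gen L)} {x : ClosedGen L} : cl T ≤ x ↔ T ⊆ x.1 := by
  refine ⟨fun h => ?_, fun h => sInf_le h⟩
  refine subset_trans ?_ (le_iff.1 h)
  exact Set.subset_sInter (by rintro _ ⟨y, hy, rfl⟩; exact hy)

lemma subset_cl (T : Set (Gen L)) : T ⊆ (cl T).1 := cl_le_iff.1 le_rfl

lemma mem_inf {x y : ClosedGen L} {z : Gen L} : z ∈ (x ⊓ y).1 ↔ z ∈ x.1 ∧ z ∈ y.1 := by
  refine ⟨fun h => ⟨le_iff.1 inf_le_left h, le_iff.1 inf_le_right h⟩, fun h => ?_⟩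
  have : cl {z} ≤ x ⊓ y :=
    le_inf (cl_le_iff.2 (by simpa using h.1)) (cl_le_iff.2 (by simpa using h.2))
  exact le_iff.1 this (subset_cl _ rfl)

lemma eq_top_of_forall_mem {x : ClosedGen L} (h : ∀ z, z ∈ x.1) : x = ⊤ :=
  top_le_iff.1 fun z _ => h z

lemma mem_top (z : Gen L) : z ∈ (⊤ : ClosedGen L).1 :=
  le_iff.1 (le_top (a := cl {z})) (subset_cl _ rfl)

lemma eq_top_of_base_top_mem {x : ClosedGen L} (h : ∀ b, base b ⊤ ∈ x.1) : x = ⊤ :=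
  eq_top_of_forall_mem (x.2.mem_of_top h)

/-- A closed set truncated at stage `n` may be enlarged by auxiliary generators over that stage. -/
lemma isClosedGen_union {x : ClosedGen L} (hx : x ≠ ⊤) (n : ℕ) (V : Set (AuxGen (Stage L n)))
    (htrace : ∀ i A, (∀ p ∈ A, ofStage n p ∈ x.1) → probe i ∈ V → trace i A ∈ V)
    (hgraph : ∀ k (F : (Fin k → Set (Stage L n)) → Set (Stage L n)) a, 0 < k →
      (∀ i : Fin k, trace i (a i) ∈ V) → graph k F ∈ V → ∀ p ∈ F a, ofStage n p ∈ x.1) :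
    IsClosedGen (x.1 ∩ upTo n ∪ aux n '' V) := by
  have key : ∀ {m} {s : AuxGen (Stage L m)}, aux m s ∈ x.1 ∩ upTo n ∪ aux n '' V →
      (m < n ∧ aux m s ∈ x.1) ∨ ∃ h : m = n, h ▸ s ∈ V := by
    rintro m s (⟨h1, h2⟩ | ⟨s', hs', h⟩)
    · exact Or.inl ⟨h2, h1⟩
    · cases h
      exact Or.inr ⟨rfl, hs'⟩
  have low : ∀ {m z}, m ≤ n → z ∈ upTo m → z ∈ x.1 ∩ upTo n ∪ aux n '' V → z ∈ x.1 := by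
    rintro m z hm hz (⟨h, -⟩ | ⟨s, -, rfl⟩)
    · exact h
    · exact absurd (aux_mem_upTo.1 hz) (by omega)
  have hbase : ∀ {b y}, base b y ∈ x.1 ∩ upTo n ∪ aux n '' V → base b y ∈ x.1 :=
    fun h => low le_rfl (base_mem_upTo _ _ _) h
  refine ⟨fun b => Or.inl ⟨x.2.bot_mem b, trivial⟩,
    fun h hz => Or.inl ⟨x.2.mem_of_le h (hbase hz), trivial⟩,
    fun hy hz => Or.inl ⟨x.2.sup_mem (hbase hy) (hbase hz), trivial⟩,
    fun h => absurd (eq_top_of_base_top_mem fun b => hbase (h b)) hx,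
    fun h => absurd ?_ (h (n + 1)), ?_, ?_⟩
  · rintro z (⟨-, hz⟩ | ⟨s, -, rfl⟩)
    · exact upTo_mono n.le_succ hz
    · exact Nat.lt_succ_self n
  · intro m i A hA hp
    rcases key hp with ⟨hm, hp⟩ | ⟨rfl, hp⟩
    · exact Or.inl ⟨x.2.trace_mem (fun p hpA => low hm.le (ofStage_mem_upTo p) (hA p hpA)) hp, hm⟩
    · exact Or.inr ⟨_, htrace i A
        (fun p hpA => low le_rfl (ofStage_mem_upTo p) (hA p hpA)) hp, rfl⟩
  · intro m k F a hk ht hg p hp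
    have hmn : m ≤ n := by
      rcases key hg with ⟨hm, -⟩ | ⟨rfl, -⟩
      exacts [hm.le, le_rfl]
    refine Or.inl ⟨?_, upTo_mono hmn (ofStage_mem_upTo p)⟩
    rcases key hg with ⟨hm, hg⟩ | ⟨rfl, hg⟩
    · exact x.2.graph_mem hk (fun i => low hm (Nat.lt_succ_self m) (ht i)) hg p hp
    · refine hgraph k F a hk (fun i => ?_) hg p hp
      rcases key (ht i) with ⟨hm, -⟩ | ⟨_, h⟩
      exacts [absurd hm (lt_irrefl _), h]

/-- The embedding of `L` as the diagonal of the two copies of `L` at stage `0`. -/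
def diag (x : L) : ClosedGen L where
  val := {z | x = ⊤ ∨ ∃ b, ∃ y ≤ x, z = base b y}
  property := by
    by_cases hx : x = ⊤
    · constructor <;> simp [hx]
    · constructor
      · exact fun b => Or.inr ⟨b, ⊥, bot_le, rfl⟩
      · intro b y z h
        simp only [Set.mem_ofPred_eq, hx, false_or, base.injEq]
        rintro ⟨_, _, hw, rfl, rfl⟩
        exact ⟨_, _, h.trans hw, rfl, rfl⟩
      · intro b y z
        simp only [Set.mem_ofPred_eq, hx, false_or, base.injEq]
        rintro ⟨_, _, hw, rfl, rfl⟩ ⟨_, _, hw', _, rfl⟩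
        exact ⟨_, _, sup_le hw hw', rfl, rfl⟩
      · intro h
        have := h true
        simp only [Set.mem_ofPred_eq, hx, false_or, base.injEq] at this
        obtain ⟨_, _, hw, _, rfl⟩ := this
        exact absurd (top_le_iff.1 hw) hx
      · refine fun h => absurd ?_ (h 0)
        rintro z (h | ⟨b, y, -, rfl⟩)
        exacts [absurd h hx, trivial]
      · intro n i A _ h
        simp [hx] at h
      · intro n k F a _ _ h
        simp [hx] at h

lemma base_mem_diag {x y : L} {b : Bool} : base b y ∈ (diag x).1 ↔ y ≤ x := by
  refine ⟨?_, fun h => Or.inr ⟨b, y, h, rfl⟩⟩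
  rintro (rfl | ⟨_, _, h, e⟩)
  · exact le_top
  · cases e
    exact h

lemma diag_le_iff {x : L} {u : ClosedGen L} : diag x ≤ u ↔ ∀ b, base b x ∈ u.1 := by
  refine ⟨fun h b => le_iff.1 h (base_mem_diag.2 le_rfl), fun h => le_iff.2 ?_⟩
  rintro z (rfl | ⟨b, y, hy, rfl⟩)
  · exact u.2.mem_of_top h z
  · exact u.2.mem_of_le hy (h b)

lemma diag_mono : Monotone (diag : L → ClosedGen L) :=
  fun _ _ h => diag_le_iff.2 fun _ => base_mem_diag.2 h

lemma isBddLatticeEmbedding_diag : IsBddLatticeEmbedding (diag : L → ClosedGen L) := by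
  refine ⟨fun x y h => ?_, fun x y => ?_, fun x y => ?_, ?_, ?_⟩
  · exact le_antisymm ((base_mem_diag (b := true)).1 (h ▸ base_mem_diag.2 le_rfl))
      ((base_mem_diag (b := true)).1 (h ▸ base_mem_diag.2 le_rfl))
  · refine le_antisymm (diag_le_iff.2 fun b => (diag x ⊔ diag y).2.sup_mem ?_ ?_)
      (sup_le (diag_mono le_sup_left) (diag_mono le_sup_right))
    · exact diag_le_iff.1 le_sup_left b
    · exact diag_le_iff.1 le_sup_right b
  · refine le_antisymm (le_inf (diag_mono inf_le_left) (diag_mono inf_le_right)) (le_iff.2 ?_)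
    intro z hz
    obtain ⟨rfl | ⟨b, w, hw, rfl⟩, h2⟩ := mem_inf.1 hz
    · rwa [top_inf_eq]
    · exact base_mem_diag.2 (le_inf hw (base_mem_diag.1 h2))
  · exact le_bot_iff.1 (diag_le_iff.2 fun b => (⊥ : ClosedGen L).2.bot_mem b)
  · exact eq_top_of_forall_mem fun z => Or.inl rfl

/-- Two sets which together make up stage `n`; both are closed if `L` is nontrivial. -/
def halfSet (L : Type u) [Lattice L] [BoundedOrder L] (n : ℕ) (c : Bool) : Set (Gen L)
  | base b y => b = c ∨ y = ⊥
  | aux m (graph _ _) => m < n ∧ c = true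
  | aux m _ => m < n ∧ c = false

lemma isClosedGen_halfSet [Nontrivial L] (n : ℕ) (c : Bool) : IsClosedGen (halfSet L n c) := by
  constructor
  · exact fun b => Or.inr rfl
  · rintro b y z h (hz | rfl)
    exacts [Or.inl hz, Or.inr (le_bot_iff.1 h)]
  · rintro b y z (hy | rfl) (hz | rfl)
    exacts [Or.inl hy, Or.inl hy, Or.inl hz, Or.inr (sup_idem _)]
  · intro h
    rcases h (!c) with h | h
    · simp at h
    · exact absurd h top_ne_bot
  · refine fun h => absurd ?_ (h n)
    rintro (⟨b, y⟩ | ⟨m, _ | _ | _⟩) hz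
    exacts [trivial, hz.1, hz.1, hz.1]
  · exact fun _ h => h
  · intro m k F a hk ht hg
    have h1 : c = false := (ht ⟨0, hk⟩).2
    have h2 : c = true := hg.2
    simp [h1] at h2

/-- The closed sets with underlying sets `halfSet`. -/
def half [Nontrivial L] (n : ℕ) (c : Bool) : ClosedGen L :=
  ⟨halfSet L n c, isClosedGen_halfSet n c⟩

lemma exists_mem_half [Nontrivial L] {n : ℕ} {z : Gen L} (hz : z ∈ upTo n) :
    ∃ c, z ∈ (half n c : ClosedGen L).1 := by
  rcases z with ⟨b, y⟩ | ⟨m, _ | _ | _⟩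
  exacts [⟨b, Or.inl rfl⟩, ⟨false, hz, rfl⟩, ⟨false, hz, rfl⟩, ⟨true, hz, rfl⟩]

lemma half_subset_upTo [Nontrivial L] (n : ℕ) (c : Bool) :
    (half n c : ClosedGen L).1 ⊆ upTo n := by
  rintro (⟨b, y⟩ | ⟨m, _ | _ | _⟩) hz
  exacts [trivial, hz.1, hz.1, hz.1]

/-- Every closed set is generated by a sufficiently late stage. -/
lemma exists_le_cl_inter_upTo (x : ClosedGen L) : ∃ n, ∀ m ≥ n, x ≤ cl (x.1 ∩ upTo m) := by
  by_cases h : ∃ n, x.1 ⊆ upTo n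
  · obtain ⟨n, hn⟩ := h
    refine ⟨n, fun m hm => le_iff.2 fun z hz => subset_cl _ ⟨hz, upTo_mono hm (hn hz)⟩⟩
  · push Not at h
    have hx := x.2.mem_of_unbounded h
    refine ⟨0, fun m _ => ?_⟩
    have htop : cl (x.1 ∩ upTo m) = ⊤ :=
      eq_top_of_base_top_mem fun b => subset_cl _ ⟨hx _, trivial⟩
    exact htop ▸ le_top

lemma bot_ne_top_of_nontrivial [Nontrivial L] : (⊥ : ClosedGen L) ≠ ⊤ := by
  intro h
  have : (diag (⊥ : L)) = diag ⊤ := by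
    rw [isBddLatticeEmbedding_diag.2.2.2.1, isBddLatticeEmbedding_diag.2.2.2.2, h]
  exact bot_ne_top (isBddLatticeEmbedding_diag.1 this)

/-- The traces `trace i A` over stage `n`. -/
def traces (L : Type u) [Lattice L] [BoundedOrder L] [Nontrivial L] (n i : ℕ) : ClosedGen L :=
  ⟨(⊥ : ClosedGen L).1 ∩ upTo n ∪ aux n '' Set.range (trace i),
    isClosedGen_union bot_ne_top_of_nontrivial n _ (by simp) (by simp)⟩

/-- The truncation of `x` at stage `n`. -/
noncomputable def trunc [Nontrivial L] (n : ℕ) (x : ClosedGen L) : ClosedGen L :=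
  ⨆ c : Bool, x ⊓ half n c

lemma trunc_le [Nontrivial L] (n : ℕ) (x : ClosedGen L) : trunc n x ≤ x :=
  iSup_le fun _ => inf_le_left

lemma mem_trunc [Nontrivial L] {n : ℕ} {x : ClosedGen L} {z : Gen L} (hx : z ∈ x.1)
    (hz : z ∈ upTo n) : z ∈ (trunc n x).1 := by
  obtain ⟨c, hc⟩ := exists_mem_half hz
  exact le_iff.1 (le_iSup (fun c => x ⊓ half n c) c) (mem_inf.2 ⟨hx, hc⟩)

lemma trunc_subset_upTo [Nontrivial L] {n : ℕ} {x : ClosedGen L} (hx : x ≠ ⊤) :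
    (trunc n x).1 ⊆ x.1 ∩ upTo n := by
  have hcl := isClosedGen_union hx n ∅ (by simp) (by simp)
  simp only [Set.image_empty, Set.union_empty] at hcl
  refine le_iff.1 (show trunc n x ≤ (⟨_, hcl⟩ : ClosedGen L) from
    iSup_le fun c => le_iff.2 fun z hz => ?_)
  obtain ⟨h1, h2⟩ := mem_inf.1 hz
  exact ⟨h1, half_subset_upTo n c h2⟩

/-- The closed set of those traces `trace i A` over stage `n` with `A` contained in `x`. -/
noncomputable def tracesOf [Nontrivial L] (n i : ℕ) (x : ClosedGen L) : ClosedGen L :=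
  (trunc n x ⊔ cl {aux n (probe i)}) ⊓ traces L n i

lemma trace_mem_tracesOf [Nontrivial L] {n i : ℕ} {x : ClosedGen L} {A : Set (Stage L n)}
    (hA : ∀ p ∈ A, ofStage n p ∈ x.1) : aux n (trace i A) ∈ (tracesOf n i x).1 := by
  refine mem_inf.2 ⟨(trunc n x ⊔ cl {aux n (probe i)}).2.trace_mem (fun p hp => ?_) ?_,
    Or.inr ⟨_, ⟨A, rfl⟩, rfl⟩⟩
  · exact le_iff.1 le_sup_left (mem_trunc (hA p hp) (ofStage_mem_upTo p))
  · exact le_iff.1 le_sup_right (subset_cl _ rfl)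

lemma tracesOf_subset [Nontrivial L] (n i : ℕ) (x : ClosedGen L) :
    (tracesOf n i x).1 ⊆
      (⊥ : ClosedGen L).1 ∪ aux n '' {s | ∃ A, s = trace i A ∧ ∀ p ∈ A, ofStage n p ∈ x.1} := by
  intro z hz
  obtain ⟨h1, h2⟩ := mem_inf.1 hz
  rcases h2 with h2 | ⟨_, ⟨A, rfl⟩, rfl⟩
  · exact Or.inl h2.1
  refine Or.inr ⟨_, ⟨A, rfl, ?_⟩, rfl⟩
  by_cases hx : x = ⊤
  · subst hx
    exact fun p _ => mem_top _
  have hcl := isClosedGen_union hx n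
    {s | s = probe i ∨ ∃ A, s = trace i A ∧ ∀ p ∈ A, ofStage n p ∈ x.1}
    (by simp +contextual) (by simp)
  have hle : trunc n x ⊔ cl {aux n (probe i)} ≤ ⟨_, hcl⟩ := by
    refine sup_le (le_iff.2 fun z hz => Or.inl (trunc_subset_upTo hx hz)) (cl_le_iff.2 ?_)
    rintro _ rfl
    exact Or.inr ⟨_, Or.inl rfl, rfl⟩
  rcases le_iff.1 hle h1 with h | ⟨s, hs, h⟩
  · exact absurd (aux_mem_upTo.1 h.2) (lt_irrefl n)
  · cases h
    simpa using hs

/-- The function on stage `n` induced by `f`. -/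
def restrict {k : ℕ} (f : (Fin k → ClosedGen L) → ClosedGen L) (n : ℕ)
    (a : Fin k → Set (Stage L n)) : Set (Stage L n) :=
  {p | ofStage n p ∈ (f fun i => cl (ofStage n '' a i)).1}

/-- A polynomial function agreeing with `f` on stage `n`. -/
noncomputable def approx [Nontrivial L] {k : ℕ} (f : (Fin k → ClosedGen L) → ClosedGen L) (n : ℕ)
    (x : Fin k → ClosedGen L) : ClosedGen L :=
  trunc n (cl {aux n (graph k (restrict f n))} ⊔ ⨆ i : Fin k, tracesOf n i (x i))

lemma approx_le [Nontrivial L] {k : ℕ} {f : (Fin k → ClosedGen L) → ClosedGen L}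
    (hf : Monotone f) (n : ℕ) (x : Fin k → ClosedGen L) : approx f n x ≤ f x := by
  by_cases hx : f x = ⊤
  · exact hx ▸ le_top
  have hcl := isClosedGen_union hx n
    {s | s = graph k (restrict f n) ∨
      ∃ i : Fin k, ∃ A, s = trace i A ∧ ∀ p ∈ A, ofStage n p ∈ (x i).1}
    (by simp) (by
      rintro l F a - ha hF p hp
      simp only [Set.mem_ofPred_eq, graph.injEq, reduceCtorEq, false_and, exists_false,
        or_false] at hF
      obtain ⟨rfl, hF⟩ := hF
      cases hF
      refine le_iff.1 (hf fun i => cl_le_iff.2 ?_) hp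
      rintro _ ⟨q, hq, rfl⟩
      obtain h | ⟨j, A, h, hA⟩ := ha i
      · cases h
      · simp only [trace.injEq] at h
        obtain ⟨hij, rfl⟩ := h
        exact Fin.ext hij ▸ hA q hq)
  have hle : cl {aux n (graph k (restrict f n))} ⊔ ⨆ i : Fin k, tracesOf n i (x i)
      ≤ ⟨_, hcl⟩ := by
    refine sup_le (cl_le_iff.2 ?_) (iSup_le fun i => le_iff.2 fun z hz => ?_)
    · rintro _ rfl
      exact Or.inr ⟨_, Or.inl rfl, rfl⟩
    · rcases tracesOf_subset n i (x i) hz with h | ⟨_, ⟨A, rfl, hA⟩, rfl⟩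
      · exact le_iff.1 (bot_le : (⊥ : ClosedGen L) ≤ ⟨_, hcl⟩) h
      · exact Or.inr ⟨_, Or.inr ⟨i, A, rfl, hA⟩, rfl⟩
  refine iSup_le fun c => le_iff.2 fun z hz => ?_
  obtain ⟨h1, h2⟩ := mem_inf.1 hz
  rcases le_iff.1 hle h1 with h | ⟨s, -, rfl⟩
  · exact h.1
  · exact absurd (aux_mem_upTo.1 (half_subset_upTo n c h2)) (lt_irrefl n)

lemma exists_le_approx [Nontrivial L] {k : ℕ} (hk : 0 < k)
    {f : (Fin k → ClosedGen L) → ClosedGen L} (hf : Monotone f) (x : Fin k → ClosedGen L) :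
    ∃ n, f x ≤ approx f n x := by
  choose N hN using fun i => exists_le_cl_inter_upTo (x i)
  obtain ⟨N', hN'⟩ := exists_le_cl_inter_upTo (f x)
  let n := max N' (Finset.univ.sup N)
  refine ⟨n, (hN' n (le_max_left _ _)).trans (cl_le_iff.2 ?_)⟩
  rintro z ⟨hz, hzn⟩
  refine mem_trunc ?_ hzn
  obtain ⟨p, rfl⟩ := exists_ofStage_eq hzn
  refine IsClosedGen.graph_mem (Subtype.property _) (F := restrict f n)
    (a := fun i => {p | ofStage n p ∈ (x i).1}) hk (fun i => ?_) ?_ p ?_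
  · exact le_iff.1 (le_sup_of_le_right (le_iSup (fun i : Fin k => tracesOf n i (x i)) i))
      (trace_mem_tracesOf fun _ h => h)
  · exact le_iff.1 le_sup_left (subset_cl _ rfl)
  · refine le_iff.1 (hf fun i => ?_) hz
    refine (hN i n ((Finset.le_sup (Finset.mem_univ i)).trans (le_max_right _ _))).trans
      (cl_le_iff.2 ?_)
    rintro w ⟨hw, hwn⟩
    obtain ⟨q, rfl⟩ := exists_ofStage_eq hwn
    exact subset_cl _ ⟨q, hw, rfl⟩

end ClosedGen

namespace IsSigmaPolyFn

variable {M : Type u} [CompleteLattice M] {k : ℕ} {p q : (Fin k → M) → M}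

lemma sup (hp : IsSigmaPolyFn M k p) (hq : IsSigmaPolyFn M k q) :
    IsSigmaPolyFn M k fun x => p x ⊔ q x := by
  simp only [sup_eq_iSup]
  refine .iSup (p := fun b x => cond b (p x) (q x)) ?_
  rintro (_ | _)
  exacts [hq, hp]

lemma inf (hp : IsSigmaPolyFn M k p) (hq : IsSigmaPolyFn M k q) :
    IsSigmaPolyFn M k fun x => p x ⊓ q x := by
  simp only [inf_eq_iInf]
  refine .iInf (p := fun b x => cond b (p x) (q x)) ?_
  rintro (_ | _)
  exacts [hq, hp]

lemma monotone (hp : IsSigmaPolyFn M k p) : Monotone p := by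
  induction hp with
  | proj i => exact fun _ _ h => h i
  | const c => exact monotone_const
  | iSup _ ih => exact fun _ _ h => iSup_mono fun i => ih i h
  | iInf _ ih => exact fun _ _ h => iInf_mono fun i => ih i h

lemma trunc {L : Type u} [Lattice L] [BoundedOrder L] [Nontrivial L]
    {p : (Fin k → ClosedGen L) → ClosedGen L} (hp : IsSigmaPolyFn (ClosedGen L) k p) (n : ℕ) :
    IsSigmaPolyFn (ClosedGen L) k fun x => ClosedGen.trunc n (p x) :=
  .iSup fun c => hp.inf (.const (ClosedGen.half n c))

lemma approx {L : Type u} [Lattice L] [BoundedOrder L] [Nontrivial L]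
    (f : (Fin k → ClosedGen L) → ClosedGen L) (n : ℕ) :
    IsSigmaPolyFn (ClosedGen L) k (ClosedGen.approx f n) :=
  trunc ((const _).sup (.iSup fun i : Fin k => (((proj i).trunc n).sup (const _)).inf (const _))) n

end IsSigmaPolyFn

lemma ClosedGen.isSigmaPolyFn_of_monotone {L : Type u} [Lattice L] [BoundedOrder L] {k : ℕ}
    {f : (Fin k → ClosedGen L) → ClosedGen L} (hf : Monotone f) :
    IsSigmaPolyFn (ClosedGen L) k f := by
  rcases subsingleton_or_nontrivial L with hL | hL
  · have h : ∀ x : ClosedGen L, x = ⊤ := fun x =>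
      eq_top_of_base_top_mem fun b => Subsingleton.elim (⊥ : L) ⊤ ▸ x.2.bot_mem b
    rw [show f = fun _ => ⊤ from funext fun x => h _]
    exact .const _
  rcases Nat.eq_zero_or_pos k with rfl | hk
  · rw [show f = fun _ => f default from funext fun x => by rw [Subsingleton.elim x default]]
    exact .const _
  have h : f = fun x => ⨆ n, approx f n x := by
    funext x
    obtain ⟨n, hn⟩ := exists_le_approx hk hf x
    exact le_antisymm (hn.trans (le_iSup (fun n => approx f n x) n))
      (iSup_le fun n => approx_le hf n x)
  rw [h]
  exact .iSup fun n => .approx f n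

/-- Every bounded lattice `L` embeds as a bounded sublattice into a complete lattice `M`
on which every σ-polynomial function is total and monotone, and on which the monotone
functions `M^k → M` are exactly the `k`-ary σ-polynomial functions. -/
theorem exists_complete_extension_monotone_eq_sigma_poly (L : Type u) [Lattice L]
    [BoundedOrder L] :
    ∃ (M : Type u) (_ : CompleteLattice M) (e : L → M),
      IsBddLatticeEmbedding e ∧
      ∀ (k : ℕ) (f : (Fin k → M) → M), Monotone f ↔ IsSigmaPolyFn M k f := by
  exact ⟨ClosedGen L, inferInstance, ClosedGen.diag, ClosedGen.isBddLatticeEmbedding_diag,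
    fun _ _ => ⟨ClosedGen.isSigmaPolyFn_of_monotone, IsSigmaPolyFn.monotone⟩⟩
end
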